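/- arXiv:2410.14447 — 5 statements merged into one kernel-verified Lean document; each statement's English description precedes it below -/
import Mathlib

section
/- Let H be a 2-connected graph on n vertices with minimum degree δ(H) ≥ n/2 − η, where n/2 − η > 1. Suppose H is not Hamiltonian, and let C be a longest cycle in H. Then there exists a set E of pairs of vertices of H, none of which is an edge of H, with |E| ≥ n²/8 − 4nη, such that for every pair e ∈ E, the graph obtained from H by adding the edge e contains a cycle strictly longer than C. -/
/-- A graph is 2-connected if it has at least 3 vertices and remains connected after the
deletion of any single vertex. -/
def TwoConnected {V : Type*} [Fintype V] (G : SimpleGraph V) : Prop :=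
  3 ≤ Fintype.card V ∧ ∀ v : V, (SimpleGraph.induce {u | u ≠ v} G).Connected

namespace SimpleGraph

variable {V : Type*} {G : SimpleGraph V} {s t u v w y z : V} {A B L X Y Q : List V}

/-- `L` lists the vertices of a path of `G` from `u` to `v`. -/
structure IsPathList (G : SimpleGraph V) (u v : V) (L : List V) : Prop where
  isChain : L.IsChain G.Adj
  nodup : L.Nodup
  head : L.head? = some u
  last : L.getLast? = some v

namespace IsPathList

theorem ne_nil (h : G.IsPathList u v L) : L ≠ [] := by
  rintro rfl
  simpa using h.head

theorem last_mem (h : G.IsPathList u v L) : v ∈ L := List.mem_of_getLast? h.last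

theorem singleton (G : SimpleGraph V) (v : V) : G.IsPathList v v [v] :=
  ⟨.singleton v, by simp, rfl, rfl⟩

theorem mono {G' : SimpleGraph V} (hG : G ≤ G') (h : G.IsPathList u v L) :
    G'.IsPathList u v L :=
  ⟨h.isChain.imp fun _ _ hab => hG hab, h.nodup, h.head, h.last⟩

theorem reverse (h : G.IsPathList u v L) : G.IsPathList v u L.reverse :=
  ⟨List.isChain_reverse.2 (h.isChain.imp fun _ _ hab => hab.symm), List.nodup_reverse.2 h.nodup,
    by simpa using h.last, by simpa using h.head⟩

theorem append (hA : G.IsPathList u y A) (hB : G.IsPathList z v B) (hyz : G.Adj y z)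
    (hd : A.Disjoint B) : G.IsPathList u v (A ++ B) where
  isChain := List.isChain_append.2 ⟨hA.isChain, hB.isChain, by
    rw [hA.last, hB.head]
    simpa using hyz⟩
  nodup := hA.nodup.append hB.nodup hd
  head := by simp [hA.head]
  last := by simp [hB.last]

theorem of_append (h : G.IsPathList u v (A ++ B)) (hA : A ≠ []) (hB : B ≠ []) :
    ∃ y z, G.IsPathList u y A ∧ G.IsPathList z v B ∧ G.Adj y z ∧ A.Disjoint B := by
  obtain ⟨hcA, hcB, hAB⟩ := List.isChain_append.1 h.isChain
  obtain ⟨hnA, hnB, hd⟩ := List.nodup_append'.1 h.nodup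
  have hlast : A.getLast? = some (A.getLast hA) := List.getLast?_eq_some_getLast hA
  have hhead : B.head? = some (B.head hB) := List.head?_eq_some_head hB
  have h1 := h.head
  have h2 := h.last
  rw [List.head?_append_of_ne_nil _ hA] at h1
  rw [List.getLast?_append_of_ne_nil _ hB] at h2
  exact ⟨_, _, ⟨hcA, hnA, h1, hlast⟩, ⟨hcB, hnB, hhead, h2⟩, hAB _ hlast _ hhead, hd⟩

theorem exists_isCycle (h : G.IsPathList u v L) (huv : G.Adj v u) (hL : 3 ≤ L.length) :
    ∃ (y : V) (c : G.Walk y y), c.IsCycle ∧ c.length = L.length := by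
  obtain ⟨p, hp⟩ : ∃ p : G.Walk u v, p.support = L := by
    have hu : L.head h.ne_nil = u := by simpa [List.head?_eq_some_head h.ne_nil] using h.head
    have hv : L.getLast h.ne_nil = v := by
      simpa [List.getLast?_eq_some_getLast h.ne_nil] using h.last
    exact ⟨(Walk.ofSupport L h.ne_nil h.isChain).copy hu hv, by simp⟩
  have hlen : p.length + 1 = L.length := by rw [← hp, Walk.length_support]
  have hpath : p.IsPath := by
    rw [Walk.isPath_def, hp]
    exact h.nodup
  refine ⟨v, .cons huv p, (Walk.cons_isCycle_iff p huv).2 ⟨hpath, fun he => ?_⟩, by simp [hlen]⟩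
  have := hpath.length_eq_one_of_mem_edges (Sym2.eq_swap ▸ he)
  omega

theorem not_adj {k : ℕ} (hmax : ∀ (y : V) (c : G.Walk y y), c.IsCycle → c.length ≤ k)
    (hk : 2 ≤ k) (h : G.IsPathList u v L) (hL : k < L.length) : ¬ G.Adj v u := fun huv => by
  obtain ⟨y, c, hc, hlen⟩ := h.exists_isCycle huv (by omega)
  have := hmax y c hc
  omega

theorem isChain_not_crossing {k : ℕ}
    (hmax : ∀ (y : V) (c : G.Walk y y), c.IsCycle → c.length ≤ k)
    (hk : 2 ≤ k) (h : G.IsPathList s t L) (hL : k < L.length) :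
    L.IsChain fun y z => ¬ (G.Adj s z ∧ G.Adj t y) := by
  rw [List.isChain_iff_forall_rel_of_append_cons_cons]
  rintro y z L₁ L₂ hLeq ⟨hsz, hty⟩
  have hLeq' : L = (L₁ ++ [y]) ++ (z :: L₂) := by simp [hLeq]
  rw [hLeq'] at h
  obtain ⟨y', z', hA, hB, -, hd⟩ := h.of_append (by simp) (by simp)
  obtain rfl : y = y' := by simpa using hA.last
  obtain rfl : z = z' := by simpa using hB.head
  refine not_adj hmax hk (hA.reverse.append hB hsz fun x hx hx' => ?_) ?_ hty
  · exact hd (List.mem_reverse.1 hx) hx'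
  · rw [hLeq', List.length_append] at hL
    rwa [List.length_append, List.length_reverse]

end IsPathList

theorem _root_.List.countP_add_countP_le_of_isChain {α : Type*} {p q : α → Bool} {a : α}
    {l : List α} (h : (a :: l).IsChain fun y z => ¬ (p z ∧ q y)) :
    l.countP p + (a :: l).countP q ≤ l.length + 1 := by
  induction l generalizing a with
  | nil => exact (Nat.zero_add _).trans_le List.countP_le_length
  | cons b l ih =>
    obtain ⟨hab, hbl⟩ := List.isChain_cons_cons.1 h
    have := ih hbl
    rw [List.countP_cons, List.countP_cons (a := a), List.length_cons]
    split_ifs <;> first | omega | simp_all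

theorem IsPathList.countP_adj_add_countP_adj_le [DecidableRel G.Adj] (h : G.IsPathList s v X)
    (hX : X.IsChain fun y z => ¬ (G.Adj s z ∧ G.Adj t y)) :
    X.countP (G.Adj s ·) + X.countP (G.Adj t ·) ≤ X.length := by
  cases X with
  | nil => simp
  | cons a l =>
    obtain rfl : a = s := by simpa using h.head
    have := List.countP_add_countP_le_of_isChain (p := (G.Adj a ·)) (q := (G.Adj t ·))
      (a := a) (l := l) (by simpa using hX)
    simpa using this

theorem degree_eq_countP_add [Fintype V] [DecidableEq V] [DecidableRel G.Adj] (hL : L.Nodup) :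
    G.degree v = L.countP (G.Adj v ·) + (G.neighborFinset v \ L.toFinset).card := by
  rw [← card_neighborFinset_eq_degree,
    ← Finset.card_inter_add_card_sdiff (G.neighborFinset v) L.toFinset,
    List.countP_eq_length_filter, ← List.toFinset_card_of_nodup (hL.filter _),
    List.toFinset_filter]
  congr 2
  ext x
  simp [and_comm]

/-- Let `X ++ Y` be a longest cycle, and let `D` be a connected set off the cycle attached to the
last vertices `b` of `X` and `a` of `Y`. The degrees of the successors `s` of `a` and `t` of `b`
then sum to at most the number of vertices outside `D`. -/
theorem IsPathList.degree_add_degree_add_card_le [Fintype V] [DecidableEq V] [DecidableRel G.Adj]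
    {a b : V} {D : Finset V}
    (hmax : ∀ (y : V) (c : G.Walk y y), c.IsCycle → c.length ≤ (X ++ Y).length)
    (hk : 2 ≤ (X ++ Y).length)
    (hX : G.IsPathList s b X) (hY : G.IsPathList t a Y) (hXY : X.Disjoint Y)
    (hbt : G.Adj b t) (has : G.Adj a s)
    (hDX : ∀ x ∈ D, x ∉ X) (hDY : ∀ x ∈ D, x ∉ Y)
    (hD : ∀ u ∈ D, ∀ w ∈ D, ∃ Q, G.IsPathList u w Q ∧ ∀ x ∈ Q, x ∈ D)
    (hu : u ∈ D) (hau : G.Adj a u) (hw : w ∈ D) (hbw : G.Adj b w) :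
    G.degree s + G.degree t + D.card ≤ Fintype.card V := by
  obtain ⟨Q, hQ, hQD⟩ := hD w hw u hu
  have hQpos := List.length_pos_iff.2 hQ.ne_nil
  have hXQ : X.Disjoint Q := fun x hx hx' => hDX x (hQD x hx') hx
  have hYQ : Y.Disjoint Q := fun x hx hx' => hDY x (hQD x hx') hx
  have hpath : G.IsPathList s t (X ++ Q ++ Y.reverse) := by
    refine (hX.append hQ hbw hXQ).append hY.reverse hau.symm fun x hx hx' => ?_
    rw [List.mem_reverse] at hx'
    rcases List.mem_append.1 hx with h | h
    exacts [hXY h hx', hYQ hx' h]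
  have hlen : (X ++ Y).length < (X ++ Q ++ Y.reverse).length := by
    simp only [List.length_append, List.length_reverse]
    omega
  have hchain := hpath.isChain_not_crossing hmax hk hlen
  have hcX := hX.countP_adj_add_countP_adj_le (t := t)
    (List.isChain_append.1 (List.isChain_append.1 hchain).1).1
  have hcY := hY.countP_adj_add_countP_adj_le (t := s) <|
    (List.isChain_reverse.1 (List.isChain_append.1 hchain).2.1).imp fun _ _ h h' => h h'.symm
  have hcycX : G.IsPathList s a (X ++ Y) := hX.append hY hbt hXY
  have hcycY : G.IsPathList t b (Y ++ X) := hY.append hX has hXY.symm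
  have hsD : ∀ x ∈ D, ¬ G.Adj s x := fun x hx hsx => by
    obtain ⟨R, hR, hRD⟩ := hD u hu x hx
    have hRpos := List.length_pos_iff.2 hR.ne_nil
    refine not_adj hmax hk (hcycX.append hR hau fun y hy hy' => ?_) (by simpa) hsx.symm
    rcases List.mem_append.1 hy with h | h
    exacts [hDX y (hRD y hy') h, hDY y (hRD y hy') h]
  have htD : ∀ x ∈ D, ¬ G.Adj t x := fun x hx htx => by
    obtain ⟨R, hR, hRD⟩ := hD w hw x hx
    have hRpos := List.length_pos_iff.2 hR.ne_nil
    refine not_adj hmax hk (hcycY.append hR hbw fun y hy hy' => ?_)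
      (by simp only [List.length_append]; omega) htx.symm
    rcases List.mem_append.1 hy with h | h
    exacts [hDY y (hRD y hy') h, hDX y (hRD y hy') h]
  set S := G.neighborFinset s \ (X ++ Y).toFinset with hS
  set T := G.neighborFinset t \ (X ++ Y).toFinset with hT
  have hST : Disjoint S T := by
    rw [Finset.disjoint_left]
    intro x hxS hxT
    simp only [hS, hT, Finset.mem_sdiff, mem_neighborFinset, List.mem_toFinset] at hxS hxT
    refine not_adj hmax hk (hpath.append (singleton G x) hxT.1 fun y hy hy' => ?_)
      (by simp only [List.length_append, List.length_reverse]; omega) hxS.1.symm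
    obtain rfl := List.mem_singleton.1 hy'
    have hyQ : y ∈ Q := by simpa [not_or.1 (List.mem_append.not.1 hxS.2)] using hy
    exact hsD y (hQD y hyQ) hxS.1
  have hSTD : Disjoint (S ∪ T) D := by
    rw [Finset.disjoint_left]
    intro x hx hxD
    rcases Finset.mem_union.1 hx with h | h
    · exact hsD x hxD (by simpa using (Finset.mem_sdiff.1 h).1)
    · exact htD x hxD (by simpa using (Finset.mem_sdiff.1 h).1)
  have hC : Disjoint ((S ∪ T) ∪ D) (X ++ Y).toFinset := by
    rw [Finset.disjoint_left]
    intro x hx hxC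
    rcases Finset.mem_union.1 hx with h | h
    · rcases Finset.mem_union.1 h with h | h <;> exact (Finset.mem_sdiff.1 h).2 hxC
    · rcases List.mem_append.1 (List.mem_toFinset.1 hxC) with h' | h'
      exacts [hDX x h h', hDY x h h']
  have htotal := Finset.card_le_univ (((S ∪ T) ∪ D) ∪ (X ++ Y).toFinset)
  rw [Finset.card_union_of_disjoint hC, Finset.card_union_of_disjoint hSTD,
    Finset.card_union_of_disjoint hST, List.toFinset_card_of_nodup hcycX.nodup,
    List.length_append] at htotal
  rw [degree_eq_countP_add (v := s) hcycX.nodup, degree_eq_countP_add (v := t) hcycX.nodup, ← hS, ← hT,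
    List.countP_append, List.countP_append]
  omega

section Rotation

variable [DecidableEq V] {C : List V} {a b : V}

theorem IsPathList.formPerm_last (h : G.IsPathList u w L) : L.formPerm w = u := by
  cases L with
  | nil => exact absurd rfl h.ne_nil
  | cons x l =>
    obtain rfl : x = u := by simpa using h.head
    have hw : (x :: l).getLast h.ne_nil = w := by
      simpa only [List.getLast?_eq_some_getLast h.ne_nil, Option.some_inj] using h.last
    rw [← hw]
    exact List.formPerm_apply_getLast x l

theorem IsPathList.exists_isRotated (h : G.IsPathList u w C) (hwu : G.Adj w u) (ha : a ∈ C) :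
    ∃ C', C' ~r C ∧ G.IsPathList (C.formPerm a) a C' ∧ G.Adj a (C.formPerm a) := by
  suffices ∃ C' u', C' ~r C ∧ G.IsPathList u' a C' ∧ G.Adj a u' by
    obtain ⟨C', u', hrot, hC', hadj⟩ := this
    obtain rfl : C.formPerm a = u' := by
      rw [← List.formPerm_eq_of_isRotated hC'.nodup hrot, hC'.formPerm_last]
    exact ⟨C', hrot, hC', hadj⟩
  obtain ⟨P, R, rfl⟩ := List.append_of_mem ha
  rcases eq_or_ne R [] with rfl | hR
  · obtain rfl : a = w := by simpa using h.last
    exact ⟨_, u, .refl _, h, hwu⟩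
  · rw [← List.singleton_append, ← List.append_assoc] at h ⊢
    obtain ⟨y, z, hP, hR', hyz, hd⟩ := h.of_append (by simp) hR
    obtain rfl : a = y := by simpa using hP.last
    exact ⟨_, z, List.isRotated_append, hR'.append hP hwu hd.symm, hyz⟩

theorem IsPathList.exists_isRotated_append (h : G.IsPathList u w C) (hwu : G.Adj w u)
    (ha : a ∈ C) (hb : b ∈ C) (hab : a ≠ b) :
    ∃ X Y, (X ++ Y) ~r C ∧ G.IsPathList (C.formPerm a) b X ∧ G.IsPathList (C.formPerm b) a Y ∧
      X.Disjoint Y ∧ G.Adj a (C.formPerm a) ∧ G.Adj b (C.formPerm b) := by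
  obtain ⟨C', hrot, hC', hadj⟩ := h.exists_isRotated hwu ha
  obtain ⟨P, R, rfl⟩ := List.append_of_mem (hrot.mem_iff.2 hb)
  have hR : R ≠ [] := by
    rintro rfl
    exact hab (by simpa using hC'.last.symm)
  rw [← List.singleton_append, ← List.append_assoc] at hC' hrot
  obtain ⟨y, z, hP, hR', hyz, hd⟩ := hC'.of_append (by simp) hR
  obtain rfl : b = y := by simpa using hP.last
  obtain rfl : C.formPerm b = z := by
    have hrot' := List.isRotated_append.trans hrot
    have hpath := hR'.append hP hadj hd.symm
    rw [← List.formPerm_eq_of_isRotated hpath.nodup hrot', hpath.formPerm_last]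
  exact ⟨_, _, hrot, hP, hR', hd, hadj, hyz⟩

/-- If a vertex `v` off a longest cycle `C` is adjacent to `a` and `b` on `C`, then joining the
successors of `a` and `b` creates a longer cycle. -/
theorem IsPathList.exists_isCycle_sup_edge (h : G.IsPathList u w C) (hwu : G.Adj w u)
    (hmax : ∀ (y : V) (c : G.Walk y y), c.IsCycle → c.length ≤ C.length)
    (hk : 2 ≤ C.length) (hv : v ∉ C) (ha : a ∈ C) (hb : b ∈ C) (hab : a ≠ b)
    (hva : G.Adj v a) (hvb : G.Adj v b) :
    ¬ G.Adj (C.formPerm a) (C.formPerm b) ∧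
      ∃ (y : V) (c : (G ⊔ fromEdgeSet {s(C.formPerm a, C.formPerm b)}).Walk y y),
        c.IsCycle ∧ C.length < c.length := by
  obtain ⟨X, Y, hrot, hX, hY, hXY, -, -⟩ := h.exists_isRotated_append hwu ha hb hab
  have hvXY : v ∉ X ++ Y := fun hv' => hv (hrot.mem_iff.1 hv')
  rw [List.mem_append, not_or] at hvXY
  have hpath : G.IsPathList (C.formPerm a) (C.formPerm b) ((X ++ [v]) ++ Y.reverse) := by
    refine (hX.append (singleton G v) hvb.symm (by simpa using hvXY.1)).append hY.reverse hva ?_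
    intro x hx hx'
    rw [List.mem_reverse] at hx'
    rcases List.mem_append.1 hx with hx | hx
    · exact hXY hx hx'
    · exact hvXY.2 (List.mem_singleton.1 hx ▸ hx')
  have hlen : ((X ++ [v]) ++ Y.reverse).length = C.length + 1 := by
    rw [← hrot.perm.length_eq]
    simp only [List.length_append, List.length_reverse, List.length_singleton]
    omega
  refine ⟨fun hadj => hpath.not_adj hmax hk (by omega) hadj.symm, ?_⟩
  obtain ⟨y, c, hc, hlen'⟩ := (hpath.mono le_sup_left).exists_isCycle
    (G := G ⊔ fromEdgeSet {s(C.formPerm a, C.formPerm b)})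
    (by simp [hab.symm, Sym2.eq_swap]) (by omega)
  exact ⟨y, c, hc, by omega⟩

end Rotation

theorem Walk.IsCycle.exists_isPathList {c : G.Walk u u} (hc : c.IsCycle) :
    ∃ (v : V) (L : List V), G.IsPathList v u L ∧ G.Adj u v ∧ L.length = c.length := by
  cases c with
  | nil => exact absurd hc Walk.not_isCycle_nil
  | @cons _ v _ huv p =>
    have hp := ((Walk.cons_isCycle_iff p huv).1 hc).1
    refine ⟨v, p.support, ⟨p.isChain_adj_support, hp.support_nodup, ?_, ?_⟩, huv, by simp⟩
    · rw [List.head?_eq_some_head p.support_ne_nil, p.head_support]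
    · rw [List.getLast?_eq_some_getLast p.support_ne_nil, p.getLast_support]

/-- A vertex outside `A` lies in a connected set `D` avoiding `A` which contains all neighbours
outside `A` of its members, namely its component in the graph with `A` removed. -/
theorem exists_isPathList_closed (G : SimpleGraph V) {A : Set V} (hv : v ∉ A) :
    ∃ D : Set V, v ∈ D ∧ (∀ x ∈ D, x ∉ A) ∧
      (∀ u ∈ D, ∀ w ∈ D, ∃ Q, G.IsPathList u w Q ∧ ∀ x ∈ Q, x ∈ D) ∧
      ∀ x ∈ D, ∀ y ∉ A, G.Adj x y → y ∈ D := by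
  classical
  refine ⟨{x | ∃ hx : x ∈ Aᶜ, (G.induce Aᶜ).Reachable ⟨v, hv⟩ ⟨x, hx⟩}, ⟨hv, .rfl⟩,
    fun x hx => hx.1, ?_, ?_⟩
  · rintro u ⟨hu, hvu⟩ w ⟨hw, hvw⟩
    obtain ⟨p, hp⟩ := (hvu.symm.trans hvw).exists_isPath
    let q := p.map (Embedding.induce Aᶜ).toHom
    have hq : q.IsPath := hp.map (Embedding.induce (G := G) Aᶜ).injective
    refine ⟨q.support, ⟨q.isChain_adj_support, hq.support_nodup, ?_, ?_⟩, ?_⟩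
    · rw [List.head?_eq_some_head q.support_ne_nil, q.head_support]
      rfl
    · rw [List.getLast?_eq_some_getLast q.support_ne_nil, q.getLast_support]
      rfl
    · intro x hx
      rw [Walk.support_map, List.mem_map] at hx
      obtain ⟨z, hz, rfl⟩ := hx
      exact ⟨z.2, hvu.trans (p.takeUntil z hz).reachable⟩
  · rintro x ⟨hx, hvx⟩ y hy hxy
    exact ⟨hy, hvx.trans (Adj.reachable (G := G.induce Aᶜ) (u := ⟨x, hx⟩) (v := ⟨y, hy⟩) hxy)⟩

end SimpleGraph

open SimpleGraph

theorem TwoConnected.exists_adj_mem {V : Type*} [Fintype V] {G : SimpleGraph V}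
    (hG : TwoConnected G) {D : Set V} {v y z : V} (hv : v ∈ D) (hvz : v ≠ z) (hy : y ∉ D)
    (hyz : y ≠ z) : ∃ a u, u ∈ D ∧ a ∉ D ∧ a ≠ z ∧ G.Adj a u := by
  obtain ⟨p⟩ := (hG.2 z).preconnected ⟨v, hvz⟩ ⟨y, hyz⟩
  obtain ⟨d, -, hd₁, hd₂⟩ := p.exists_boundary_dart (Subtype.val ⁻¹' D) hv hy
  exact ⟨d.snd, d.fst, hd₁, hd₂, d.snd.2, d.adj.symm⟩

/-- A vertex `v` off a longest cycle `C` of a 2-connected graph of minimum degree at least `δ` has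
more than `3 * δ - |V|` neighbours on `C`. -/
theorem TwoConnected.three_mul_lt_card_inter {V : Type*} [Fintype V] [DecidableEq V]
    {G : SimpleGraph V} [DecidableRel G.Adj] (hG : TwoConnected G) {δ : ℝ}
    (hδ : ∀ v, δ ≤ G.degree v) {C : List V} {u v w : V} (hC : G.IsPathList u w C)
    (hwu : G.Adj w u) (hmax : ∀ (y : V) (c : G.Walk y y), c.IsCycle → c.length ≤ C.length)
    (hk : 2 ≤ C.length) (hv : v ∉ C) :
    2 * δ + 1 ≤ Fintype.card V ∧
      3 * δ + 1 ≤ Fintype.card V + ((G.neighborFinset v ∩ C.toFinset).card : ℝ) := by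
  classical
  obtain ⟨D, hvD, hDC, hD, hDcl⟩ := G.exists_isPathList_closed (A := {x | x ∈ C}) hv
  have hattach : ∀ z ∈ C, ∃ a u, u ∈ D ∧ a ∈ C ∧ a ≠ z ∧ G.Adj a u := by
    intro z hz
    obtain ⟨y, hy, hyz⟩ : ∃ y ∈ C, y ≠ z := by
      by_contra! hall
      have := List.toFinset_card_of_nodup hC.nodup
      have := Finset.card_le_card (s := C.toFinset) (t := {z})
        fun y hy => Finset.mem_singleton.2 (hall y (List.mem_toFinset.1 hy))
      rw [Finset.card_singleton] at this
      omega
    obtain ⟨a, u, hu, ha, haz, hau⟩ := hG.exists_adj_mem (D := D) (z := z) hvD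
      (by rintro rfl; exact hv hz) (fun hyD => hDC y hyD hy) hyz
    exact ⟨a, u, hu, by_contra fun haC => ha (hDcl u hu a haC hau.symm), haz, hau⟩
  obtain ⟨a, ua, hua, ha, -, haua⟩ := hattach w hC.last_mem
  obtain ⟨b, ub, hub, hb, hba, hbub⟩ := hattach a ha
  obtain ⟨X, Y, hrot, hX, hY, hXY, has, hbt⟩ := hC.exists_isRotated_append hwu ha hb hba.symm
  have hlen := hrot.perm.length_eq
  have hmem : ∀ x, x ∈ X ++ Y ↔ x ∈ C := fun x => hrot.mem_iff
  have key := hX.degree_add_degree_add_card_le (D := D.toFinset) (hlen ▸ hmax) (hlen ▸ hk) hY hXY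
    hbt has
    (fun x hx hxX => hDC x (Set.mem_toFinset.1 hx) ((hmem x).1 (List.mem_append_left _ hxX)))
    (fun x hx hxY => hDC x (Set.mem_toFinset.1 hx) ((hmem x).1 (List.mem_append_right _ hxY)))
    (by simpa using hD) (Set.mem_toFinset.2 hua) haua (Set.mem_toFinset.2 hub) hbub
  have hdeg : G.degree v + 1 ≤ (G.neighborFinset v ∩ C.toFinset).card + D.toFinset.card := by
    have hsub : G.neighborFinset v \ C.toFinset ⊆ D.toFinset.erase v := fun x hx => by
      rw [Finset.mem_sdiff, mem_neighborFinset, List.mem_toFinset] at hx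
      exact Finset.mem_erase.2 ⟨hx.1.ne', Set.mem_toFinset.2 (hDcl v hvD x hx.2 hx.1)⟩
    have h1 := Finset.card_le_card hsub
    have h2 := Finset.card_erase_add_one (Set.mem_toFinset.2 hvD)
    rw [← card_neighborFinset_eq_degree,
      ← Finset.card_inter_add_card_sdiff (G.neighborFinset v) C.toFinset]
    omega
  have hDpos : 1 ≤ D.toFinset.card := Finset.card_pos.2 ⟨v, Set.mem_toFinset.2 hvD⟩
  have h1 := hδ (C.formPerm a)
  have h2 := hδ (C.formPerm b)
  have h3 := hδ v
  rify at key hdeg hDpos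
  constructor <;> linarith

/-- Let `H` be a 2-connected graph on `n` vertices with minimum degree
`δ(H) ≥ n/2 − η`, where `n/2 − η > 1`. Suppose `H` is not Hamiltonian, and let `C` be a
longest cycle in `H`. Then there exists a set `E` of non-edges of `H` with
`|E| ≥ n²/8 − 4nη` such that adding any `e ∈ E` to `H` creates a cycle strictly longer
than `C`. -/
theorem statement10 {V : Type*} [Fintype V] [DecidableEq V]
    (n : ℕ) (hn : Fintype.card V = n) (η : ℝ)
    (H : SimpleGraph V)
    (h2conn : TwoConnected H)
    (hd : (1 : ℝ) < (n : ℝ) / 2 - η)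
    (hδ : ∀ v : V, (n : ℝ) / 2 - η ≤ (H.neighborSet v).ncard)
    (hnotham : ¬ H.IsHamiltonian)
    (x : V) (c : H.Walk x x) (hc : c.IsCycle)
    (hlongest : ∀ (y : V) (c' : H.Walk y y), c'.IsCycle → c'.length ≤ c.length) :
    ∃ E : Finset (Sym2 V),
      (∀ e ∈ E, ¬ e.IsDiag ∧ e ∉ H.edgeSet) ∧
      (n : ℝ) ^ 2 / 8 - 4 * n * η ≤ E.card ∧
      ∀ e ∈ E, ∃ (y : V) (c' : (H ⊔ SimpleGraph.fromEdgeSet {e}).Walk y y),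
        c'.IsCycle ∧ c.length < c'.length := by
  classical
  obtain ⟨u, C, hC, hxu, hlen⟩ := hc.exists_isPathList
  rw [← hlen] at hlongest ⊢
  have hk : 2 ≤ C.length := by
    have := hc.three_le_length
    omega
  have hδ' : ∀ v, (n : ℝ) / 2 - η ≤ H.degree v := fun v => by
    simpa [Set.ncard_eq_toFinset_card', ← card_neighborFinset_eq_degree, neighborFinset]
      using hδ v
  obtain ⟨v, hv⟩ : ∃ v, v ∉ C := by
    by_contra! hall
    refine hnotham fun _ => ⟨x, c, Walk.isHamiltonianCycle_iff_isCycle_and_length_eq.2 ⟨hc, ?_⟩⟩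
    rw [← hlen, ← List.toFinset_card_of_nodup hC.nodup,
      Finset.eq_univ_of_forall fun v => List.mem_toFinset.2 (hall v), Finset.card_univ]
  obtain ⟨hη, hcard⟩ := h2conn.three_mul_lt_card_inter hδ' hC hxu hlongest hk hv
  rw [hn] at hη hcard
  set F := H.neighborFinset v ∩ C.toFinset with hF
  have hboost : ∀ e ∈ (F.map C.formPerm.toEmbedding).offDiag.image Sym2.mk.uncurry, ∃ a b,
      a ≠ b ∧ a ∈ C ∧ b ∈ C ∧ H.Adj v a ∧ H.Adj v b ∧ e = s(C.formPerm a, C.formPerm b) := by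
    intro e he
    simp only [Finset.mem_image, Finset.mem_offDiag, Finset.mem_map, hF, Finset.mem_inter,
      mem_neighborFinset, List.mem_toFinset] at he
    obtain ⟨⟨_, _⟩, ⟨⟨a, ha, rfl⟩, ⟨b, hb, rfl⟩, hab⟩, rfl⟩ := he
    exact ⟨a, b, fun h => hab (by rw [h]), ha.2, hb.2, ha.1, hb.1, rfl⟩
  refine ⟨(F.map C.formPerm.toEmbedding).offDiag.image Sym2.mk.uncurry, fun e he => ?_, ?_,
    fun e he => ?_⟩
  · obtain ⟨a, b, hab, ha, hb, hva, hvb, rfl⟩ := hboost e he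
    exact ⟨by simpa using hab,
      (hC.exists_isCycle_sup_edge hxu hlongest hk hv ha hb hab hva hvb).1⟩
  · have h2 := Sym2.two_mul_card_image_offDiag (F.map C.formPerm.toEmbedding)
    rw [Finset.offDiag_card, Finset.card_map] at h2
    have h3 : (2 * ((F.map C.formPerm.toEmbedding).offDiag.image Sym2.mk.uncurry).card : ℝ)
        = F.card * F.card - F.card := by
      rw [← Nat.cast_mul F.card, ← Nat.cast_sub (Nat.le_mul_self F.card), ← h2]
      push_cast
      rfl
    have hn0 : (0 : ℝ) ≤ n := n.cast_nonneg
    rcases le_total 0 ((n : ℝ) / 2 - 3 * η) with hm | hm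
    · have hF1 : (n : ℝ) / 2 - 3 * η + 1 ≤ F.card := by linarith
      nlinarith [mul_le_mul hF1 (sub_le_sub_right hF1 1) (by linarith) (by linarith)]
    · have hE : (0 : ℝ) ≤ ((F.map C.formPerm.toEmbedding).offDiag.image Sym2.mk.uncurry).card :=
        Nat.cast_nonneg _
      nlinarith
  · obtain ⟨a, b, hab, ha, hb, hva, hvb, rfl⟩ := hboost e he
    exact (hC.exists_isCycle_sup_edge hxu hlongest hk hv ha hb hab hva hvb).2
end

section
/- Let H be a 2-connected graph on n vertices with minimum degree δ(H) ≥ n/2 − η, where n/2 − η > 1. Suppose H is not Hamiltonian, let C be a longest cycle in H with a fixed cyclic orientation, and let v be a vertex of H not on C. For a vertex w of C, let w⁻ and w⁺ denote the predecessor and successor of w along the orientation of C. Let W_v be the set of vertices w of C such that w is not adjacent to v but both w⁻ and w⁺ are adjacent to v. Then |W_v| ≥ n/2 − 9η. -/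
/-- `IsOrientation c nxt prv` expresses that the functions `nxt` and `prv` give, for each
vertex `w` of the cycle `c`, its successor `w⁺ = nxt w` and predecessor `w⁻ = prv w` along a
fixed cyclic orientation of `c`. -/
def IsOrientation {V : Type*} {G : SimpleGraph V} {x : V} (c : G.Walk x x)
    (nxt prv : V → V) : Prop :=
  ∀ w ∈ c.support,
    nxt w ∈ c.support ∧ prv w ∈ c.support ∧
    s(w, nxt w) ∈ c.edges ∧ s(prv w, w) ∈ c.edges ∧
    prv (nxt w) = w ∧ nxt (prv w) = w ∧ nxt w ≠ prv w

/-- `L` is the list of vertices of a path of `H` from `a` to `b`. -/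
structure IsListPath {V : Type*} (H : SimpleGraph V) (L : List V) (a b : V) : Prop where
  nodup : L.Nodup
  chain : L.IsChain H.Adj
  head : L.head? = some a
  last : L.getLast? = some b

/-- `F` enumerates, in cyclic order, the vertices of a cycle of `H` of length `m`, and no cycle
of `H` (given as a list of its vertices) is longer. -/
structure IsLongestCycle {V : Type*} (H : SimpleGraph V) (m : ℕ) (F : ZMod m → V) : Prop where
  three_le : 3 ≤ m
  injective : Function.Injective F
  adj : ∀ i, H.Adj (F i) (F (i + 1))
  length_le : ∀ (l : List V) (a b : V), IsListPath H l a b → H.Adj b a → 3 ≤ l.length →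
    l.length ≤ m

section

variable {V : Type*} {H : SimpleGraph V} {m : ℕ} {F : ZMod m → V} {L : List V} {a b : V}

theorem IsListPath.reverse (h : IsListPath H L a b) : IsListPath H L.reverse b a where
  nodup := List.nodup_reverse.2 h.nodup
  chain := by
    rw [List.isChain_reverse]
    exact h.chain.imp fun _ _ h => h.symm
  head := by rw [List.head?_reverse, h.last]
  last := by rw [List.getLast?_reverse, h.head]

theorem IsListPath.singleton (a : V) : IsListPath H [a] a a where
  nodup := List.nodup_singleton a
  chain := by simp
  head := rfl
  last := rfl

theorem exists_isCycle_of_list {l : List V} (h : IsListPath H l a b) (hab : H.Adj b a)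
    (h3 : 3 ≤ l.length) : ∃ (y : V) (c : H.Walk y y), c.IsCycle ∧ c.length = l.length := by
  have hne : l ≠ [] := by rintro rfl; simp at h3
  obtain rfl : l.head hne = a := by
    have := h.head
    rw [List.head?_eq_some_head hne] at this
    simpa using this
  obtain rfl : l.getLast hne = b := by
    have := h.last
    rw [List.getLast?_eq_some_getLast hne] at this
    simpa using this
  have hp : (SimpleGraph.Walk.ofSupport l hne h.chain).IsPath := by
    rw [SimpleGraph.Walk.isPath_def, SimpleGraph.Walk.support_ofSupport]
    exact h.nodup
  have hl := SimpleGraph.Walk.length_ofSupport hne h.chain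
  refine ⟨_, .cons hab (.ofSupport l hne h.chain), ?_, ?_⟩
  · rw [SimpleGraph.Walk.cons_isCycle_iff]
    refine ⟨hp, fun he => ?_⟩
    rw [Sym2.eq_swap] at he
    have := hp.length_eq_one_of_mem_edges he
    omega
  · rw [SimpleGraph.Walk.length_cons]
    omega

theorem natCast_zmod_inj {i j : ℕ} (hi : i < m) (hj : j < m) (h : (i : ZMod m) = j) : i = j := by
  rw [ZMod.natCast_eq_natCast_iff', Nat.mod_eq_of_lt hi, Nat.mod_eq_of_lt hj] at h
  exact h

/-- Attachment points of the two ends of a path outside a longest cycle are not too close. -/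
theorem IsLongestCycle.not_close (hF : IsLongestCycle H m F) (hL : IsListPath H L a b)
    (hdis : ∀ i, F i ∉ L) {i : ZMod m} {k : ℕ} (hk : 1 ≤ k) (hkL : k ≤ L.length) (hkm : k < m)
    (hia : H.Adj (F i) a) (hib : H.Adj (F (i + k)) b) : False := by
  set arc := (List.range (m - k + 1)).map (fun t : ℕ => F (i + k + t)) with harc
  have harc_head : arc.head? = some (F (i + k)) := by
    simp [harc, List.range_succ_eq_map]
  have harc_last : arc.getLast? = some (F i) := by
    have : (k : ZMod m) + ((m - k : ℕ) : ZMod m) = 0 := by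
      rw [← Nat.cast_add, Nat.add_sub_cancel' hkm.le, ZMod.natCast_self]
    simp [harc, List.range_succ, add_assoc, this]
  have hlen : (arc ++ L).length = m - k + 1 + L.length := by simp [harc]
  have h3 := hF.three_le
  have := hF.length_le (arc ++ L) (F (i + k)) b ⟨?_, ?_, ?_, ?_⟩ hib.symm ?_
  · omega
  · refine List.nodup_append'.2 ⟨?_, hL.nodup, ?_⟩
    · refine List.Nodup.map_on ?_ List.nodup_range
      intro s hs t ht hst
      rw [List.mem_range] at hs ht
      exact natCast_zmod_inj (by omega) (by omega) (add_left_cancel (hF.injective hst))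
    · intro z hz
      rw [harc, List.mem_map] at hz
      obtain ⟨t, -, rfl⟩ := hz
      exact hdis _
  · rw [List.isChain_append]
    refine ⟨?_, hL.chain, ?_⟩
    · rw [harc, List.isChain_map, List.isChain_range]
      intro t _
      simpa [add_assoc] using hF.adj (i + k + t)
    · rw [harc_last, hL.head]
      simpa using hia
  · simp [harc_head]
  · simp [hL.last]
  · omega

theorem IsLongestCycle.not_adj_succ (hF : IsLongestCycle H m F) (ha : ∀ i, F i ≠ a) {i : ZMod m}
    (h : H.Adj (F i) a) : ¬ H.Adj (F (i + 1)) a := fun h' =>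
  hF.not_close (IsListPath.singleton a) (by simpa using ha) (k := 1) le_rfl le_rfl
    (by have := hF.three_le; omega) h (by simpa using h')

open Classical in
/-- The attachment points on the cycle of a vertex. -/
noncomputable def attach [NeZero m] (H : SimpleGraph V) (F : ZMod m → V) (a : V) :
    Finset (ZMod m) :=
  Finset.univ.filter fun i => H.Adj (F i) a

theorem mem_attach [NeZero m] {i : ZMod m} : i ∈ attach H F a ↔ H.Adj (F i) a := by
  simp [attach]

theorem IsLongestCycle.two_mul_length_add_le [NeZero m] (hF : IsLongestCycle H m F)
    (hL : IsListPath H L a b) (hdis : ∀ i, F i ∉ L) {j : ZMod m} (hj : H.Adj (F j) b)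
    (hne : ((attach H F a).erase j).Nonempty) :
    2 * L.length + 2 * ((attach H F a).erase j).card ≤ m := by
  classical
  have hLne : L ≠ [] := by
    rintro rfl
    simpa using hL.head
  have hL1 : 1 ≤ L.length := List.length_pos_iff.2 hLne
  have haL : a ∈ L := List.mem_of_mem_head? (by rw [hL.head]; simp)
  have ha : ∀ i, F i ≠ a := fun i h => hdis i (h ▸ haL)
  have h3 := hF.three_le
  set q := L.length
  set I := ((attach H F a).erase j).image (fun t => (t - j).val) with hI
  have hIcard : I.card = ((attach H F a).erase j).card := by
    refine Finset.card_image_of_injective _ fun s t hst => ?_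
    exact sub_left_injective (ZMod.val_injective m hst)
  have hImem : ∀ k ∈ I, H.Adj (F (j + k)) a ∧ q + 1 ≤ k ∧ k + q + 1 ≤ m := by
    intro k hk
    obtain ⟨t, ht, rfl⟩ := Finset.mem_image.1 hk
    rw [Finset.mem_erase, mem_attach] at ht
    have hlt : (t - j).val < m := ZMod.val_lt _
    have hpos : 1 ≤ (t - j).val := by
      rw [Nat.one_le_iff_ne_zero, Ne, ZMod.val_eq_zero, sub_eq_zero]
      exact ht.1
    have hadj : H.Adj (F (j + ((t - j).val : ZMod m))) a := by
      simpa using ht.2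
    refine ⟨hadj, ?_, ?_⟩
    · by_contra hcon
      exact hF.not_close hL.reverse (by simpa using hdis) hpos (by simp; omega) hlt hj hadj
    · by_contra hcon
      refine hF.not_close hL hdis (k := m - (t - j).val) (by omega) (by omega) (by omega) hadj ?_
      rwa [add_assoc, ← Nat.cast_add, Nat.add_sub_cancel' hlt.le, ZMod.natCast_self, add_zero]
  have hdisj : Disjoint I (I.image (· + 1)) := by
    rw [Finset.disjoint_left]
    intro k hk hk'
    obtain ⟨t, ht, rfl⟩ := Finset.mem_image.1 hk'
    refine hF.not_adj_succ ha (hImem t ht).1 ?_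
    simpa [add_assoc] using (hImem _ hk).1
  have hsub : I ∪ I.image (· + 1) ⊆ Finset.Icc (q + 1) (m - q) := by
    intro k hk
    rw [Finset.mem_Icc]
    rcases Finset.mem_union.1 hk with hk | hk
    · have := hImem k hk
      omega
    · obtain ⟨t, ht, rfl⟩ := Finset.mem_image.1 hk
      have := hImem t ht
      omega
  have hle := Finset.card_le_card hsub
  rw [Finset.card_union_of_disjoint hdisj, Finset.card_image_of_injective _ (add_left_injective 1),
    Nat.card_Icc, hIcard] at hle
  have := Finset.card_pos.2 hne
  omega

theorem IsLongestCycle.two_mul_attach_add_le [NeZero m] (hF : IsLongestCycle H m F)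
    (hL : IsListPath H L a b) (hdis : ∀ i, F i ∉ L) (hm : 4 ≤ m) (hlen : 3 ≤ L.length) :
    2 * (attach H F a).card + 2 * (attach H F b).card ≤ m := by
  classical
  have haL : a ∈ L := List.mem_of_mem_head? (by rw [hL.head]; simp)
  have hbL : b ∈ L := List.mem_of_getLast? hL.last
  have ha : ∀ i, F i ≠ a := fun i h => hdis i (h ▸ haL)
  have hb : ∀ i, F i ≠ b := fun i h => hdis i (h ▸ hbL)
  have key : ∀ (i : ZMod m) (k : ℕ), 1 ≤ k → k ≤ 3 → i + k ∈ attach H F a →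
      i ∈ attach H F b → False := fun i k h1 h2 h3 h4 =>
    hF.not_close hL.reverse (by simpa using hdis) h1 (by simp; omega) (by omega)
      (mem_attach.1 h4) (mem_attach.1 h3)
  set A := attach H F a
  set B := attach H F b
  have hA : Disjoint A (A.image (· + 1)) := by
    rw [Finset.disjoint_left]
    intro t ht ht'
    obtain ⟨s, hs, rfl⟩ := Finset.mem_image.1 ht'
    exact hF.not_adj_succ ha (mem_attach.1 hs) (mem_attach.1 ht)
  have hB : Disjoint (B.image (· + 2)) (B.image (· + 3)) := by
    rw [Finset.disjoint_left]
    intro t ht ht'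
    obtain ⟨s, hs, rfl⟩ := Finset.mem_image.1 ht'
    obtain ⟨r, hr, hrs⟩ := Finset.mem_image.1 ht
    obtain rfl : r = s + 1 := by linear_combination hrs
    exact hF.not_adj_succ hb (mem_attach.1 hs) (mem_attach.1 hr)
  have hAB : Disjoint (A ∪ A.image (· + 1)) (B.image (· + 2) ∪ B.image (· + 3)) := by
    rw [Finset.disjoint_left]
    intro t ht ht'
    rcases Finset.mem_union.1 ht with ht | ht <;> rcases Finset.mem_union.1 ht' with ht' | ht' <;>
      obtain ⟨s, hs, hst⟩ := Finset.mem_image.1 ht'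
    · exact key s 2 (by norm_num) (by norm_num) (by simpa [hst] using ht) hs
    · exact key s 3 (by norm_num) (by norm_num) (by simpa [hst] using ht) hs
    · obtain ⟨r, hr, hrt⟩ := Finset.mem_image.1 ht
      obtain rfl : r = s + 1 := by linear_combination hrt - hst
      exact key s 1 (by norm_num) (by norm_num) (by simpa using hr) hs
    · obtain ⟨r, hr, hrt⟩ := Finset.mem_image.1 ht
      obtain rfl : r = s + 2 := by linear_combination hrt - hst
      exact key s 2 (by norm_num) (by norm_num) (by simpa using hr) hs
  have hle := Finset.card_le_univ ((A ∪ A.image (· + 1)) ∪ (B.image (· + 2) ∪ B.image (· + 3)))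
  rw [Finset.card_union_of_disjoint hAB, Finset.card_union_of_disjoint hA,
    Finset.card_union_of_disjoint hB, Finset.card_image_of_injective _ (add_left_injective 1),
    Finset.card_image_of_injective _ (add_left_injective 2),
    Finset.card_image_of_injective _ (add_left_injective 3), ZMod.card] at hle
  omega

end

section

variable {V : Type*} {H : SimpleGraph V}

/-- A graph of minimum degree at least `δ ≥ 2` has a cycle of length at least `δ + 1`. -/
theorem exists_list_cycle [Fintype V] [Nonempty V] {δ : ℕ} (hδ2 : 2 ≤ δ)
    (hδ : ∀ u, δ ≤ (H.neighborSet u).ncard) :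
    ∃ (l : List V) (a b : V), IsListPath H l a b ∧ H.Adj b a ∧ δ + 1 ≤ l.length := by
  classical
  let P : ℕ → Prop := fun k => ∃ l : List V, l.Nodup ∧ l.IsChain H.Adj ∧ l.length = k
  have hP : ∀ k, P k → k ≤ Fintype.card V := by
    rintro k ⟨l, hl, -, rfl⟩
    exact hl.length_le_card
  have h1 : P 1 := ⟨[Classical.arbitrary V], by simp, by simp, rfl⟩
  obtain ⟨l, hnd, hch, hlen⟩ := Nat.findGreatest_spec (hP 1 h1) h1
  have hmax : ∀ l' : List V, l'.Nodup → l'.IsChain H.Adj → l'.length ≤ l.length := by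
    intro l' h h'
    rw [hlen]
    exact Nat.le_findGreatest (hP _ ⟨l', h, h', rfl⟩) ⟨l', h, h', rfl⟩
  obtain - | ⟨x, t⟩ := l
  · have := hmax [Classical.arbitrary V] (by simp) (by simp)
    simp at this
  have hnb : ∀ y, H.Adj x y → y ∈ t := by
    intro y hy
    by_contra hyt
    have := hmax (y :: x :: t)
      (List.nodup_cons.2 ⟨by simp [hyt, hy.ne'], hnd⟩) (List.isChain_cons_cons.2 ⟨hy.symm, hch⟩)
    simp at this
  let I := (Finset.range t.length).filter fun i => ∃ h : i < t.length, H.Adj x t[i]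
  have hIne : I.Nonempty := by
    have hpos : (H.neighborSet x).ncard ≠ 0 := by have := hδ x; omega
    obtain ⟨y, hy⟩ := Set.nonempty_of_ncard_ne_zero hpos
    obtain ⟨i, hi, rfl⟩ := List.mem_iff_getElem.1 (hnb y hy)
    exact ⟨i, by simpa [I, hi] using hy⟩
  obtain ⟨hj, hj', hadj⟩ : I.max' hIne ∈ Finset.range t.length ∧
      ∃ h : I.max' hIne < t.length, H.Adj x t[I.max' hIne] :=
    Finset.mem_filter.1 (I.max'_mem hIne)
  set j := I.max' hIne with hjdef
  refine ⟨x :: t.take (j + 1), x, t[j], ⟨?_, ?_, rfl, ?_⟩, hadj.symm, ?_⟩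
  · exact hnd.sublist ((List.take_sublist _ _).cons_cons x)
  · have := hch.take (j + 2)
    simpa using this
  · rw [List.getLast?_cons, List.getLast?_take]
    simp [hj']
  · have hsub : H.neighborSet x ⊆ ((t.take (j + 1)).toFinset : Set V) := by
      intro y hy
      obtain ⟨i, hi, rfl⟩ := List.mem_iff_getElem.1 (hnb y hy)
      have : i ≤ j := I.le_max' i (by simpa [I, hi] using hy)
      simp only [List.coe_toFinset, Set.mem_ofPred_eq]
      exact List.mem_take_iff_getElem.2 ⟨i, by omega, rfl⟩
    have h2 := Set.ncard_le_ncard hsub (Finset.finite_toSet _)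
    rw [Set.ncard_coe_finset] at h2
    have h3 := List.toFinset_card_le (t.take (j + 1))
    have := hδ x
    simp only [List.length_cons]
    omega

end

section

variable {V : Type*} {G : SimpleGraph V} {K : Finset V} {a b : V} {f : ℕ → V}

/-- `f` enumerates `K` on `0, …, |K| - 1`, starting at `a` and ending at `b`. -/
structure IsArrangement (K : Finset V) (a b : V) (f : ℕ → V) : Prop where
  mem : ∀ t < K.card, f t ∈ K
  inj : ∀ s < K.card, ∀ t < K.card, f s = f t → s = t
  zero : f 0 = a
  last : f (K.card - 1) = b

open Classical in
/-- The positions at which consecutive vertices of an arrangement are not adjacent. -/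
noncomputable def defects (G : SimpleGraph V) (K : Finset V) (f : ℕ → V) : Finset ℕ :=
  (Finset.range (K.card - 1)).filter fun t => ¬ G.Adj (f t) (f (t + 1))

theorem mem_defects {t : ℕ} :
    t ∈ defects G K f ↔ t < K.card - 1 ∧ ¬ G.Adj (f t) (f (t + 1)) := by
  simp [defects]

/-- Reversing a segment of an arrangement reduces the number of defects, provided the two new
consecutive pairs are adjacent and one of the two old ones is not. -/
theorem IsArrangement.exists_defects_lt (hf : IsArrangement K a b f) {i j : ℕ} (hji : j < i)
    (hi : i < K.card - 1) (h1 : G.Adj (f j) (f i)) (h2 : G.Adj (f (j + 1)) (f (i + 1)))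
    (h3 : j ∈ defects G K f ∨ i ∈ defects G K f) :
    ∃ f', IsArrangement K a b f' ∧ (defects G K f').card < (defects G K f).card := by
  classical
  let ρ : ℕ → ℕ := fun t => if j + 1 ≤ t ∧ t ≤ i then i + j + 1 - t else t
  let φ : ℕ → ℕ := fun t => if j + 1 ≤ t ∧ t < i then i + j - t else t
  have hρ : ∀ t < K.card, ρ t < K.card := by
    intro t ht
    simp only [ρ]
    split_ifs <;> omega
  have hφ : Function.Injective φ := by
    intro s t hst
    simp only [φ] at hst
    split_ifs at hst <;> omega
  refine ⟨f ∘ ρ, ⟨fun t ht => hf.mem _ (hρ t ht), ?_, ?_, ?_⟩, ?_⟩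
  · intro s hs t ht hst
    have := hf.inj _ (hρ s hs) _ (hρ t ht) hst
    simp only [ρ] at this
    split_ifs at this <;> omega
  · have : ρ 0 = 0 := by simp [ρ]
    simp [this, hf.zero]
  · have : ρ (K.card - 1) = K.card - 1 := if_neg (by omega)
    simp [this, hf.last]
  · have hmaps : ∀ t ∈ defects G K (f ∘ ρ), φ t ∈ defects G K f ∧ φ t ≠ j ∧ φ t ≠ i := by
      intro t ht
      rw [mem_defects] at ht
      obtain ⟨htl, htn⟩ := ht
      simp only [Function.comp_apply] at htn
      have htj : t ≠ j := by
        rintro rfl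
        have e1 : ρ t = t := if_neg (by omega)
        have e2 : ρ (t + 1) = i := by
          simp only [ρ]
          rw [if_pos (by omega)]
          omega
        rw [e1, e2] at htn
        exact htn h1
      have hti : t ≠ i := by
        rintro rfl
        have e1 : ρ t = j + 1 := by
          simp only [ρ]
          rw [if_pos (by omega)]
          omega
        have e2 : ρ (t + 1) = t + 1 := if_neg (by omega)
        rw [e1, e2] at htn
        exact htn h2
      by_cases hin : j + 1 ≤ t ∧ t < i
      · have e0 : φ t = i + j - t := if_pos hin
        have e1 : ρ t = i + j - t + 1 := by
          simp only [ρ]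
          rw [if_pos (by omega)]
          omega
        have e2 : ρ (t + 1) = i + j - t := by
          simp only [ρ]
          rw [if_pos (by omega)]
          omega
        rw [e1, e2] at htn
        rw [e0, mem_defects]
        exact ⟨⟨by omega, fun h => htn h.symm⟩, by omega, by omega⟩
      · have e0 : φ t = t := if_neg hin
        have e1 : ρ t = t := if_neg (by omega)
        have e2 : ρ (t + 1) = t + 1 := if_neg (by omega)
        rw [e1, e2] at htn
        rw [e0, mem_defects]
        exact ⟨⟨htl, htn⟩, htj, hti⟩
    rw [← Finset.card_image_of_injective _ hφ]
    apply Finset.card_lt_card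
    rw [Finset.ssubset_iff_of_subset]
    · rcases h3 with h3 | h3
      · refine ⟨j, h3, fun hj => ?_⟩
        obtain ⟨t, ht, htφ⟩ := Finset.mem_image.1 hj
        exact (hmaps t ht).2.1 htφ
      · refine ⟨i, h3, fun hi => ?_⟩
        obtain ⟨t, ht, htφ⟩ := Finset.mem_image.1 hi
        exact (hmaps t ht).2.2 htφ
    · intro y hy
      obtain ⟨t, ht, rfl⟩ := Finset.mem_image.1 hy
      exact (hmaps t ht).1

theorem IsArrangement.exists_eq (hf : IsArrangement K a b f) {z : V} (hz : z ∈ K) :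
    ∃ t < K.card, f t = z := by
  classical
  have hinj : Set.InjOn f (Finset.range K.card : Set ℕ) := by
    intro s hs t ht h
    exact hf.inj s (by simpa using hs) t (by simpa using ht) h
  have hsub : (Finset.range K.card).image f ⊆ K := by
    intro y hy
    obtain ⟨t, ht, rfl⟩ := Finset.mem_image.1 hy
    exact hf.mem t (Finset.mem_range.1 ht)
  have := Finset.eq_of_subset_of_card_le hsub
    (by rw [Finset.card_image_of_injOn hinj, Finset.card_range])
  rw [← this] at hz
  obtain ⟨t, ht, rfl⟩ := Finset.mem_image.1 hz
  exact ⟨t, Finset.mem_range.1 ht, rfl⟩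

theorem exists_isArrangement (ha : a ∈ K) (hb : b ∈ K) (hab : a ≠ b) :
    ∃ f, IsArrangement K a b f := by
  classical
  set l := a :: (((K.erase a).erase b).toList ++ [b]) with hl
  have hbK : b ∈ K.erase a := Finset.mem_erase.2 ⟨hab.symm, hb⟩
  have hpos : 0 < (K.erase a).card := Finset.card_pos.2 ⟨b, hbK⟩
  have hlen : l.length = K.card := by
    simp only [hl, List.length_cons, List.length_append, Finset.length_toList, List.length_nil]
    rw [Finset.card_erase_of_mem hbK, Finset.card_erase_of_mem ha] at *
    omega
  have hmem : ∀ z ∈ l, z ∈ K := by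
    intro z hz
    simp only [hl, List.mem_cons, List.mem_append, Finset.mem_toList, Finset.mem_erase,
      List.not_mem_nil, or_false] at hz
    rcases hz with rfl | hz | rfl
    exacts [ha, hz.2.2, hb]
  have hnd : l.Nodup := by
    rw [hl, List.nodup_cons, List.nodup_append']
    refine ⟨by simp [hab], Finset.nodup_toList _, by simp, by simp⟩
  refine ⟨fun t => l.getD t a, ⟨?_, ?_, by simp [hl], ?_⟩⟩
  · intro t ht
    rw [← hlen] at ht
    simp only [List.getD_eq_getElem _ _ ht]
    exact hmem _ (List.getElem_mem _)
  · intro s hs t ht hst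
    rw [← hlen] at hs ht
    simp only [List.getD_eq_getElem _ _ hs, List.getD_eq_getElem _ _ ht] at hst
    exact (hnd.getElem_inj_iff).1 hst
  · have h1 : K.card - 1 < l.length := by
      have := Finset.card_pos.2 ⟨a, ha⟩
      omega
    simp only [List.getD_eq_getElem _ _ h1]
    have : l[K.card - 1] = l.getLast (by simp [hl]) := by
      rw [List.getLast_eq_getElem]
      congr 1
      omega
    rw [this]
    simp [hl]

open Classical in
/-- Ore's condition for being Hamilton-connected, for the subgraph induced on `K`. -/
theorem exists_spanning_isListPath (ha : a ∈ K) (hb : b ∈ K) (hab : a ≠ b)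
    (hore : ∀ x ∈ K, ∀ y ∈ K, x ≠ y → ¬ G.Adj x y →
      K.card + 1 ≤ (K.filter (G.Adj x)).card + (K.filter (G.Adj y)).card) :
    ∃ L, IsListPath G L a b ∧ (∀ z ∈ L, z ∈ K) ∧ L.length = K.card := by
  obtain ⟨f, hf, hmin⟩ : ∃ f, IsArrangement K a b f ∧
      ∀ f', IsArrangement K a b f' → (defects G K f).card ≤ (defects G K f').card := by
    obtain ⟨f, hf, hmin⟩ := (measure fun f => (defects G K f).card).wf.has_min
      {f | IsArrangement K a b f} (exists_isArrangement ha hb hab)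
    exact ⟨f, hf, fun f' hf' => not_lt.1 (hmin f' hf')⟩
  have hcard : 0 < K.card := Finset.card_pos.2 ⟨a, ha⟩
  have hno : ∀ i < K.card - 1, G.Adj (f i) (f (i + 1)) := by
    by_contra! hcon
    obtain ⟨i, hi, hia⟩ := hcon
    have hdef : i ∈ defects G K f := mem_defects.2 ⟨hi, hia⟩
    set X := (Finset.range (K.card - 1)).filter fun t => G.Adj (f i) (f t) with hX
    set Y := (Finset.range (K.card - 1)).filter fun t => G.Adj (f (i + 1)) (f (t + 1)) with hY
    have hdisj : Disjoint X Y := by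
      rw [Finset.disjoint_left]
      intro j hjX hjY
      simp only [hX, hY, Finset.mem_filter, Finset.mem_range] at hjX hjY
      rcases lt_trichotomy j i with hlt | rfl | hlt
      · obtain ⟨f', hf', hlt'⟩ :=
          hf.exists_defects_lt hlt hi hjX.2.symm hjY.2.symm (Or.inr hdef)
        exact absurd (hmin f' hf') (not_le.2 hlt')
      · exact hjX.2.ne rfl
      · obtain ⟨f', hf', hlt'⟩ :=
          hf.exists_defects_lt hlt hjX.1 hjX.2 hjY.2 (Or.inl hdef)
        exact absurd (hmin f' hf') (not_le.2 hlt')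
    have hsub : X ∪ Y ⊆ (Finset.range (K.card - 1)).erase i := by
      intro t ht
      simp only [hX, hY, Finset.mem_union, Finset.mem_filter, Finset.mem_range] at ht
      rw [Finset.mem_erase, Finset.mem_range]
      rcases ht with ht | ht
      · exact ⟨fun h => ht.2.ne (by rw [h]), ht.1⟩
      · exact ⟨fun h => ht.2.ne (by rw [h]), ht.1⟩
    have hle := Finset.card_le_card hsub
    rw [Finset.card_union_of_disjoint hdisj, Finset.card_erase_of_mem (Finset.mem_range.2 hi),
      Finset.card_range] at hle
    have hXle : (K.filter (G.Adj (f i))).card ≤ X.card + 1 := by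
      refine le_trans (Finset.card_le_card ?_)
        ((Finset.card_insert_le (f (K.card - 1)) (X.image f)).trans
          (Nat.add_le_add_right Finset.card_image_le 1))
      intro z hz
      rw [Finset.mem_filter] at hz
      obtain ⟨t, ht, rfl⟩ := hf.exists_eq hz.1
      rw [Finset.mem_insert, Finset.mem_image]
      by_cases h : t = K.card - 1
      · exact Or.inl (by rw [h])
      · exact Or.inr ⟨t, Finset.mem_filter.2 ⟨Finset.mem_range.2 (by omega), hz.2⟩, rfl⟩
    have hYle : (K.filter (G.Adj (f (i + 1)))).card ≤ Y.card + 1 := by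
      refine le_trans (Finset.card_le_card ?_)
        ((Finset.card_insert_le (f 0) (Y.image fun t => f (t + 1))).trans
          (Nat.add_le_add_right Finset.card_image_le 1))
      intro z hz
      rw [Finset.mem_filter] at hz
      obtain ⟨t, ht, rfl⟩ := hf.exists_eq hz.1
      rw [Finset.mem_insert, Finset.mem_image]
      obtain - | t := t
      · exact Or.inl rfl
      · exact Or.inr ⟨t, Finset.mem_filter.2 ⟨Finset.mem_range.2 (by omega), hz.2⟩, rfl⟩
    have := hore (f i) (hf.mem i (by omega)) (f (i + 1)) (hf.mem _ (by omega))
      (fun h => by have := hf.inj _ (by omega) _ (by omega) h; omega) hia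
    omega
  refine ⟨(List.range K.card).map f, ⟨?_, ?_, ?_, ?_⟩, ?_, by simp⟩
  · exact List.Nodup.map_on (fun s hs t ht h =>
      hf.inj s (List.mem_range.1 hs) t (List.mem_range.1 ht) h) List.nodup_range
  · rw [List.isChain_map, List.isChain_range]
    exact hno
  · rw [List.head?_map, List.head?_range, if_neg hcard.ne']
    simp [hf.zero]
  · rw [List.getLast?_map, List.getLast?_range, if_neg hcard.ne']
    simp [hf.last]
  · intro z hz
    obtain ⟨t, ht, rfl⟩ := List.mem_map.1 hz
    exact hf.mem t (List.mem_range.1 ht)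

end

section

variable {V : Type*} {H : SimpleGraph V} {m : ℕ} {F : ZMod m → V}

/-- The subgraph of `H` obtained by isolating the vertices of the cycle. -/
def outside (H : SimpleGraph V) (F : ZMod m → V) : SimpleGraph V where
  Adj x y := H.Adj x y ∧ (∀ i, F i ≠ x) ∧ ∀ i, F i ≠ y
  symm := ⟨fun _ _ h => ⟨h.1.symm, h.2.2, h.2.1⟩⟩
  loopless := ⟨fun _ h => h.1.ne rfl⟩

theorem ne_of_reachable_outside {v z : V} (hv : ∀ i, F i ≠ v)
    (hz : (outside H F).Reachable v z) : ∀ i, F i ≠ z := by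
  rw [SimpleGraph.reachable_iff_reflTransGen] at hz
  cases hz with
  | refl => exact hv
  | tail _ h => exact h.2.2

theorem reachable_outside_of_adj {v x y : V} (hv : ∀ i, F i ≠ v)
    (hx : (outside H F).Reachable v x) (hxy : H.Adj x y) (hy : ∀ i, F i ≠ y) :
    (outside H F).Reachable v y :=
  hx.trans (SimpleGraph.Adj.reachable (G := outside H F)
    ⟨hxy, ne_of_reachable_outside hv hx, hy⟩)

theorem exists_isListPath_outside {v x y : V} (hv : ∀ i, F i ≠ v)
    (hx : (outside H F).Reachable v x) (hy : (outside H F).Reachable v y) (hne : x ≠ y)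
    (hxy : ¬ H.Adj x y) :
    ∃ L, IsListPath H L x y ∧ (∀ i, F i ∉ L) ∧ 3 ≤ L.length := by
  classical
  obtain ⟨p, hp⟩ := (hx.symm.trans hy).exists_isPath
  refine ⟨p.support, ⟨hp.support_nodup, ?_, ?_, ?_⟩, ?_, ?_⟩
  · exact p.isChain_adj_support.imp fun _ _ h => h.1
  · rw [List.head?_eq_some_head p.support_ne_nil, SimpleGraph.Walk.head_support]
  · rw [List.getLast?_eq_some_getLast p.support_ne_nil, SimpleGraph.Walk.getLast_support]
  · intro i hi
    exact ne_of_reachable_outside hv (hx.trans (p.takeUntil _ hi).reachable) i rfl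
  · cases p with
    | nil => exact absurd rfl hne
    | cons h q =>
      cases q with
      | nil => exact absurd h.1 hxy
      | cons h' q => simp

theorem exists_adj_avoiding [Fintype V] (h2 : TwoConnected H) {v : V} (hv : ∀ i, F i ≠ v)
    (z : V) (hK : ∃ k, (outside H F).Reachable v k ∧ k ≠ z) (hC : ∃ j, F j ≠ z) :
    ∃ k i, (outside H F).Reachable v k ∧ H.Adj (F i) k ∧ k ≠ z ∧ F i ≠ z := by
  obtain ⟨k, hk, hkz⟩ := hK
  obtain ⟨j, hj⟩ := hC
  obtain ⟨p⟩ := (h2.2 z).preconnected ⟨k, hkz⟩ ⟨F j, hj⟩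
  obtain ⟨d, -, hd1, hd2⟩ := p.exists_boundary_dart {x | (outside H F).Reachable v x.1} hk
    fun h => ne_of_reachable_outside hv h j rfl
  have hadj : H.Adj d.fst.1 d.snd.1 := d.adj
  have : ∃ i, F i = d.snd.1 := by
    by_contra! hcon
    exact hd2 (reachable_outside_of_adj hv hd1 hadj hcon)
  obtain ⟨i, hi⟩ := this
  refine ⟨d.fst.1, i, hd1, ?_, d.fst.2, ?_⟩
  · rw [hi]
    exact hadj.symm
  · rw [hi]
    exact d.snd.2

/-- Between a component of the complement of the cycle with at least two vertices and the cycle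
there are two disjoint edges. -/
theorem exists_disjoint_adj [Fintype V] (h2 : TwoConnected H) (hF : IsLongestCycle H m F)
    {v w : V} (hv : ∀ i, F i ≠ v) (hw : (outside H F).Reachable v w) (hvw : v ≠ w) :
    ∃ a b i j, (outside H F).Reachable v a ∧ (outside H F).Reachable v b ∧ a ≠ b ∧ i ≠ j ∧
      H.Adj (F i) a ∧ H.Adj (F j) b := by
  have hK : ∀ z, ∃ k, (outside H F).Reachable v k ∧ k ≠ z := by
    intro z
    by_cases h : v = z
    · exact ⟨w, hw, fun h' => hvw (h.trans h'.symm)⟩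
    · exact ⟨v, .refl v, h⟩
  have hC : ∀ z, ∃ j, F j ≠ z := by
    intro z
    by_cases h : F 0 = z
    · exact ⟨0 + 1, fun h' => (hF.adj 0).ne (h.trans h'.symm)⟩
    · exact ⟨0, h⟩
  obtain ⟨a₀, i₀, ha₀, hi₀, -, -⟩ := exists_adj_avoiding h2 hv v (hK v) (hC v)
  obtain ⟨a₁, i₁, ha₁, hi₁, -, hne₁⟩ := exists_adj_avoiding h2 hv (F i₀) (hK _) (hC _)
  have hi01 : i₀ ≠ i₁ := by
    rintro rfl
    exact hne₁ rfl
  by_cases h01 : a₀ = a₁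
  · subst h01
    obtain ⟨a₂, i₂, ha₂, hi₂, hne₂, -⟩ := exists_adj_avoiding h2 hv a₀ (hK _) (hC _)
    by_cases h : i₂ = i₀
    · exact ⟨a₀, a₂, i₁, i₂, ha₀, ha₂, hne₂.symm, h ▸ hi01.symm, hi₁, hi₂⟩
    · exact ⟨a₀, a₂, i₀, i₂, ha₀, ha₂, hne₂.symm, Ne.symm h, hi₀, hi₂⟩
  · exact ⟨a₀, a₁, i₀, i₁, ha₀, ha₁, h01, hi01, hi₀, hi₁⟩

/-- In a dense 2-connected graph, a longest cycle that misses a vertex has length at least twice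
the minimum degree. -/
theorem IsLongestCycle.two_mul_le [Fintype V] [NeZero m] (h2 : TwoConnected H)
    (hF : IsLongestCycle H m F) {η : ℝ} (hd : 1 < (Fintype.card V : ℝ) / 2 - η)
    (hδ : ∀ u, (Fintype.card V : ℝ) / 2 - η ≤ (H.neighborSet u).ncard)
    (hη : 9 * η < (Fintype.card V : ℝ) / 2) {v : V} (hv : ∀ i, F i ≠ v) :
    2 * ((Fintype.card V : ℝ) / 2 - η) ≤ m := by
  classical
  set n := Fintype.card V
  set d : ℝ := (n : ℝ) / 2 - η with hd_def
  have h3 := hF.three_le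
  have hlong : d + 1 ≤ m := by
    have : Nonempty V := ⟨v⟩
    have hceil : 2 ≤ ⌈d⌉₊ := Nat.lt_ceil.2 (by simpa using hd)
    obtain ⟨l, a, b, hl, hba, hlen⟩ :=
      exists_list_cycle (H := H) hceil fun u => Nat.ceil_le.2 (hδ u)
    have := hF.length_le l a b hl hba (by omega)
    have h' : ((⌈d⌉₊ + 1 : ℕ) : ℝ) ≤ m := by exact_mod_cast hlen.trans this
    push_cast at h'
    linarith [Nat.le_ceil d]
  set K : Finset V := Finset.univ.filter fun z => (outside H F).Reachable v z with hKdef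
  have hmemK : ∀ z, z ∈ K ↔ (outside H F).Reachable v z := by simp [hKdef]
  have hout : ∀ z ∈ K, ∀ i, F i ≠ z := fun z hz =>
    ne_of_reachable_outside hv ((hmemK z).1 hz)
  have hvK : v ∈ K := (hmemK v).2 (.refl v)
  have hcard : (m : ℝ) + K.card ≤ n := by
    have hdisj : Disjoint (Finset.univ.image F) K := by
      rw [Finset.disjoint_left]
      intro z hz hzK
      obtain ⟨i, -, rfl⟩ := Finset.mem_image.1 hz
      exact hout _ hzK i rfl
    have := Finset.card_le_univ (Finset.univ.image F ∪ K)
    rw [Finset.card_union_of_disjoint hdisj, Finset.card_image_of_injective _ hF.injective,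
      Finset.card_univ, ZMod.card] at this
    exact_mod_cast this
  have hdeg : ∀ x ∈ K, d ≤ (K.filter (H.Adj x)).card + (attach H F x).card := by
    intro x hx
    have hsub : H.neighborSet x ⊆
        ((K.filter (H.Adj x) ∪ (attach H F x).image F : Finset V) : Set V) := by
      intro y hy
      rw [SimpleGraph.mem_neighborSet] at hy
      rw [Finset.mem_coe, Finset.mem_union, Finset.mem_filter, Finset.mem_image]
      by_cases h : ∃ i, F i = y
      · obtain ⟨i, rfl⟩ := h
        exact Or.inr ⟨i, mem_attach.2 hy.symm, rfl⟩
      · push Not at h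
        exact Or.inl ⟨(hmemK y).2 (reachable_outside_of_adj hv ((hmemK x).1 hx) hy h), hy⟩
    have h1 := Set.ncard_le_ncard hsub (Finset.finite_toSet _)
    rw [Set.ncard_coe_finset] at h1
    have h4 := h1.trans ((Finset.card_union_le _ _).trans
      (Nat.add_le_add_left Finset.card_image_le _))
    calc d ≤ (H.neighborSet x).ncard := hδ x
      _ ≤ _ := by exact_mod_cast h4
  have hdeg' : ∀ x ∈ K, d ≤ K.card - 1 + (attach H F x).card := by
    intro x hx
    have hsub : K.filter (H.Adj x) ⊆ K.erase x := by
      intro y hy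
      rw [Finset.mem_filter] at hy
      exact Finset.mem_erase.2 ⟨hy.2.ne', hy.1⟩
    have h1 := Finset.card_le_card hsub
    have h4 := Finset.card_erase_add_one hx
    have h5 : ((K.filter (H.Adj x)).card : ℝ) + 1 ≤ K.card := by
      exact_mod_cast (by omega : (K.filter (H.Adj x)).card + 1 ≤ K.card)
    linarith [hdeg x hx]
  obtain ⟨L, a, b, j, hL, hLK, hLlen, haK, hjb, hne⟩ : ∃ L a b j, IsListPath H L a b ∧
      (∀ z ∈ L, z ∈ K) ∧ L.length = K.card ∧ a ∈ K ∧ H.Adj (F j) b ∧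
      ((attach H F a).erase j).Nonempty := by
    by_cases hK1 : ∃ w ∈ K, v ≠ w
    · obtain ⟨w, hwK, hvw⟩ := hK1
      obtain ⟨a, b, i, j, ha, hb, hab, hij, hia, hjb⟩ :=
        exists_disjoint_adj h2 hF hv ((hmemK w).1 hwK) hvw
      have hore : ∀ x ∈ K, ∀ y ∈ K, x ≠ y → ¬ H.Adj x y →
          K.card + 1 ≤ (K.filter (H.Adj x)).card + (K.filter (H.Adj y)).card := by
        intro x hx y hy hxy hnadj
        obtain ⟨L, hL, hdis, hlen⟩ :=
          exists_isListPath_outside hv ((hmemK x).1 hx) ((hmemK y).1 hy) hxy hnadj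
        have hK2 : (2 : ℝ) ≤ K.card := by
          exact_mod_cast Finset.one_lt_card.2 ⟨x, hx, y, hy, hxy⟩
        have hm3 : (3 : ℝ) ≤ m := by exact_mod_cast h3
        have hm : 4 ≤ m := by
          have : (3 : ℝ) < m := by linarith
          exact_mod_cast this
        have hatt : 2 * ((attach H F x).card : ℝ) + 2 * (attach H F y).card ≤ m := by
          exact_mod_cast hF.two_mul_attach_add_le hL hdis hm hlen
        have hm4 : 4 * η + 2 ≤ m := by
          rcases le_or_gt (4 * η) 1 with h | h <;> linarith
        have h5 := hdeg x hx
        have h6 := hdeg y hy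
        have : (K.card : ℝ) + 1 ≤ (K.filter (H.Adj x)).card + (K.filter (H.Adj y)).card := by
          linarith
        exact_mod_cast this
      obtain ⟨L, hL, hLK, hLlen⟩ := exists_spanning_isListPath ((hmemK a).2 ha)
        ((hmemK b).2 hb) hab fun x hx y hy hxy h => by convert hore x hx y hy hxy h
      exact ⟨L, a, b, j, hL, hLK, hLlen, (hmemK a).2 ha, hjb, i,
        Finset.mem_erase.2 ⟨hij, mem_attach.2 hia⟩⟩
    · push Not at hK1
      have hKv : K = {v} := Finset.eq_singleton_iff_unique_mem.2 ⟨hvK, fun w hw => (hK1 w hw).symm⟩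
      have hK1' : K.card = 1 := by simp [hKv]
      have h1 := hdeg' v hvK
      rw [hK1'] at h1
      have : 1 < (attach H F v).card := by
        have : (1 : ℝ) < (attach H F v).card := by
          push_cast at h1
          linarith
        exact_mod_cast this
      obtain ⟨j, hj, i, hi, hij⟩ := Finset.one_lt_card.1 this
      exact ⟨[v], v, v, j, .singleton v, by simpa using hvK, by simp [hK1'], hvK, mem_attach.1 hj,
        i, Finset.mem_erase.2 ⟨hij.symm, hi⟩⟩
  have hfin := hF.two_mul_length_add_le hL (fun i hi => hout _ (hLK _ hi) i rfl) hjb hne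
  have herase := Finset.pred_card_le_card_erase (s := attach H F a) (a := j)
  have h1 : 2 * K.card + 2 * (attach H F a).card ≤ m + 2 := by omega
  have h1' : 2 * (K.card : ℝ) + 2 * (attach H F a).card ≤ m + 2 := by exact_mod_cast h1
  linarith [hdeg' a haK]

end

section

variable {V : Type*} {H : SimpleGraph V} {x : V} {c : H.Walk x x}

/-- The enumeration of the vertices of a closed walk by residues modulo its length. -/
def cyclicVert (c : H.Walk x x) (i : ZMod c.length) : V := c.getVert i.val

theorem cyclicVert_natCast {k : ℕ} (hk : k ≤ c.length) :
    cyclicVert c (k : ZMod c.length) = c.getVert k := by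
  rw [cyclicVert, ZMod.val_natCast]
  rcases hk.lt_or_eq with h | h
  · rw [Nat.mod_eq_of_lt h]
  · rw [h, Nat.mod_self, SimpleGraph.Walk.getVert_length, SimpleGraph.Walk.getVert_zero]

theorem cyclicVert_mem_support (i : ZMod c.length) : cyclicVert c i ∈ c.support :=
  c.getVert_mem_support _

theorem exists_cyclicVert_eq {w : V} (hw : w ∈ c.support) : ∃ i, cyclicVert c i = w := by
  obtain ⟨k, rfl, hk⟩ := SimpleGraph.Walk.mem_support_iff_exists_getVert.1 hw
  exact ⟨k, cyclicVert_natCast hk⟩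

theorem exists_cyclicVert_of_mem_edges {u w : V} (h : s(u, w) ∈ c.edges) :
    ∃ i, s(cyclicVert c i, cyclicVert c (i + 1)) = s(u, w) := by
  obtain ⟨k, hk, he⟩ := (c.mk_mem_edges_iff_exists).1 h
  refine ⟨k, ?_⟩
  rw [← he, cyclicVert_natCast hk.le, ← Nat.cast_add_one, cyclicVert_natCast hk]

theorem isLongestCycle_cyclicVert (hc : c.IsCycle)
    (hlongest : ∀ (y : V) (c' : H.Walk y y), c'.IsCycle → c'.length ≤ c.length) :
    IsLongestCycle H c.length (cyclicVert c) where
  three_le := hc.three_le_length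
  injective := by
    have : NeZero c.length := ⟨by have := hc.three_le_length; omega⟩
    intro i j hij
    have hi := ZMod.val_lt i
    have hj := ZMod.val_lt j
    exact ZMod.val_injective _
      (hc.getVert_injOn' (by simp; omega) (by simp; omega) hij)
  adj i := by
    have : NeZero c.length := ⟨by have := hc.three_le_length; omega⟩
    have hi := ZMod.val_lt i
    have h := c.adj_getVert_succ hi
    rw [← cyclicVert_natCast hi.le, ← cyclicVert_natCast hi] at h
    simpa using h
  length_le l a b hl hab h3 := by
    obtain ⟨y, c', hc', hlen⟩ := exists_isCycle_of_list hl hab h3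
    exact hlen ▸ hlongest y c' hc'

theorem card_support_toFinset [DecidableEq V] (hc : c.IsCycle) :
    c.support.toFinset.card = c.length := by
  have h : c.support = x :: c.support.tail := c.cons_tail_support.symm
  have hx : x ∈ c.support.tail := c.end_mem_tail_support hc.not_nil
  rw [h, List.toFinset_cons, Finset.insert_eq_of_mem (by simpa using hx),
    List.toFinset_card_of_nodup hc.support_nodup, List.length_tail,
    SimpleGraph.Walk.length_support, Nat.add_sub_cancel]

end

/-- If a set `N` of vertices of an oriented cycle contains no two consecutive vertices, then at
least `3|N| - |C|` vertices of the cycle lie between two members of `N`. -/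
theorem three_mul_card_le {V : Type*} [DecidableEq V] {C N : Finset V} {nxt prv : V → V}
    (hNC : N ⊆ C) (hnxt : ∀ w ∈ C, nxt w ∈ C) (hprv : ∀ w ∈ C, prv w ∈ C)
    (hpn : ∀ w ∈ C, prv (nxt w) = w) (hnp : ∀ w ∈ C, nxt (prv w) = w)
    (hN : ∀ w ∈ N, nxt w ∉ N) :
    3 * N.card ≤ C.card + (C.filter fun w => w ∉ N ∧ prv w ∈ N ∧ nxt w ∈ N).card := by
  have hinj₁ : (N.image nxt).card = N.card := by
    refine Finset.card_image_of_injOn fun s hs t ht hst => ?_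
    rw [← hpn s (hNC hs), ← hpn t (hNC ht)]
    exact congrArg prv hst
  have hinj₂ : (N.image prv).card = N.card := by
    refine Finset.card_image_of_injOn fun s hs t ht hst => ?_
    rw [← hnp s (hNC hs), ← hnp t (hNC ht)]
    exact congrArg nxt hst
  have hdisj : Disjoint N (N.image nxt ∪ N.image prv) := by
    rw [Finset.disjoint_left]
    intro w hw hw'
    rcases Finset.mem_union.1 hw' with h | h <;> obtain ⟨t, ht, rfl⟩ := Finset.mem_image.1 h
    · exact hN t ht hw
    · exact hN _ hw (by rwa [hnp t (hNC ht)])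
  have hsub : N ∪ (N.image nxt ∪ N.image prv) ⊆ C := by
    refine Finset.union_subset hNC (Finset.union_subset ?_ ?_) <;>
      refine Finset.image_subset_iff.2 fun w hw => ?_
    exacts [hnxt w (hNC hw), hprv w (hNC hw)]
  have hinter : N.image nxt ∩ N.image prv ⊆
      C.filter fun w => w ∉ N ∧ prv w ∈ N ∧ nxt w ∈ N := by
    intro w hw
    obtain ⟨h1, h2⟩ := Finset.mem_inter.1 hw
    obtain ⟨s, hs, rfl⟩ := Finset.mem_image.1 h1
    obtain ⟨t, ht, hst⟩ := Finset.mem_image.1 h2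
    refine Finset.mem_filter.2 ⟨hnxt s (hNC hs), hN s hs, ?_, ?_⟩
    · rwa [hpn s (hNC hs)]
    · rwa [← hst, hnp t (hNC ht)]
  have h1 := Finset.card_le_card hsub
  have h2 := Finset.card_le_card hinter
  have h3 := Finset.card_union_add_card_inter (N.image nxt) (N.image prv)
  rw [Finset.card_union_of_disjoint hdisj] at h1
  omega

/-- Let `H` be a 2-connected non-Hamiltonian graph on `n` vertices with
minimum degree `δ(H) ≥ n/2 − η`, where `n/2 − η > 1`, let `C` be a longest cycle in `H` with a
fixed cyclic orientation, and let `v` be a vertex not on `C`. Let `W_v` be the set of vertices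
`w` of `C` such that `w` is not adjacent to `v` but both `w⁻` and `w⁺` are adjacent to `v`.
Then `|W_v| ≥ n/2 − 9η`. -/
theorem statement14 {V : Type*} [Fintype V] [DecidableEq V]
    (n : ℕ) (hn : Fintype.card V = n) (η : ℝ)
    (H : SimpleGraph V)
    (h2conn : TwoConnected H)
    (hd : (1 : ℝ) < (n : ℝ) / 2 - η)
    (hδ : ∀ u : V, (n : ℝ) / 2 - η ≤ (H.neighborSet u).ncard)
    (hnotham : ¬ H.IsHamiltonian)
    (x : V) (c : H.Walk x x) (hc : c.IsCycle)
    (hlongest : ∀ (y : V) (c' : H.Walk y y), c'.IsCycle → c'.length ≤ c.length)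
    (nxt prv : V → V) (horient : IsOrientation c nxt prv)
    (v : V) (hv : v ∉ c.support) :
    (n : ℝ) / 2 - 9 * η ≤
      ({w | w ∈ c.support ∧ ¬ H.Adj v w ∧ H.Adj v (prv w) ∧ H.Adj v (nxt w)} : Set V).ncard := by
  subst hn
  rcases le_or_gt ((Fintype.card V : ℝ) / 2) (9 * η) with hη | hη
  · exact le_trans (by linarith) (Nat.cast_nonneg _)
  classical
  have : NeZero c.length := ⟨by have := hc.three_le_length; omega⟩
  have hF := isLongestCycle_cyclicVert hc hlongest
  have hvF : ∀ i, cyclicVert c i ≠ v := fun i h => hv (h ▸ cyclicVert_mem_support i)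
  have hlen := hF.two_mul_le h2conn hd hδ hη hvF
  set C := c.support.toFinset with hC
  have hCcard : C.card = c.length := card_support_toFinset hc
  have hvC : v ∉ C := by simpa [hC] using hv
  set N := C.filter (H.Adj v) with hN
  have hnb : (H.neighborSet v).ncard ≤ N.card + ((insert v C)ᶜ).card := by
    rw [← Set.ncard_coe_finset N, ← Set.ncard_coe_finset (insert v C)ᶜ]
    refine le_trans (Set.ncard_le_ncard ?_ (Set.toFinite _)) (Set.ncard_union_le _ _)
    intro y hy
    rw [SimpleGraph.mem_neighborSet] at hy
    by_cases h : y ∈ C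
    · exact Or.inl (by simp [hN, h, hy])
    · exact Or.inr (by simp [h, hy.ne'])
  rw [Finset.card_compl, Finset.card_insert_of_notMem hvC, hCcard] at hnb
  have hle : c.length + 1 ≤ Fintype.card V := by
    rw [← hCcard, ← Finset.card_insert_of_notMem hvC]
    exact Finset.card_le_univ _
  have hmem : ∀ {w}, w ∈ C ↔ w ∈ c.support := by simp [hC]
  have hkey := three_mul_card_le (C := C) (N := N) (nxt := nxt) (prv := prv)
    (Finset.filter_subset _ _) (fun w hw => hmem.2 (horient w (hmem.1 hw)).1)
    (fun w hw => hmem.2 (horient w (hmem.1 hw)).2.1)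
    (fun w hw => (horient w (hmem.1 hw)).2.2.2.2.1)
    (fun w hw => (horient w (hmem.1 hw)).2.2.2.2.2.1) ?_
  · have hW : ({w | w ∈ c.support ∧ ¬ H.Adj v w ∧ H.Adj v (prv w) ∧ H.Adj v (nxt w)} :
        Set V) = (C.filter fun w => w ∉ N ∧ prv w ∈ N ∧ nxt w ∈ N : Finset V) := by
      ext w
      simp only [Set.mem_ofPred_eq, Finset.coe_filter, hN, Finset.mem_filter, hmem]
      constructor
      · rintro ⟨h1, h2, h3, h4⟩
        exact ⟨h1, fun h => h2 h.2, ⟨(horient w h1).2.1, h3⟩, ⟨(horient w h1).1, h4⟩⟩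
      · rintro ⟨h1, h2, h3, h4⟩
        exact ⟨h1, fun h => h2 ⟨h1, h⟩, h3.2, h4.2⟩
    rw [hW, Set.ncard_coe_finset]
    rw [hCcard] at hkey
    have hkey' : 3 * (N.card : ℝ) ≤ c.length +
        (C.filter fun w => w ∉ N ∧ prv w ∈ N ∧ nxt w ∈ N).card := by exact_mod_cast hkey
    have hnb' : ((H.neighborSet v).ncard : ℝ) + c.length + 1 ≤ N.card + Fintype.card V := by
      exact_mod_cast (by omega :
        (H.neighborSet v).ncard + c.length + 1 ≤ N.card + Fintype.card V)
    have hle' : (c.length : ℝ) + 1 ≤ Fintype.card V := by exact_mod_cast hle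
    have := hδ v
    linarith
  · intro w hw hw'
    obtain ⟨hwC, hvw⟩ := Finset.mem_filter.1 hw
    have hvw' := (Finset.mem_filter.1 hw').2
    obtain ⟨i, hi⟩ := exists_cyclicVert_of_mem_edges (horient w (hmem.1 hwC)).2.2.1
    have h12 : H.Adj v (cyclicVert c i) ∧ H.Adj v (cyclicVert c (i + 1)) := by
      rcases Sym2.eq_iff.1 hi with ⟨h1, h2⟩ | ⟨h1, h2⟩ <;> rw [h1, h2]
      exacts [⟨hvw, hvw'⟩, ⟨hvw', hvw⟩]
    exact hF.not_adj_succ hvF h12.1.symm h12.2.symm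
end

section
/- Let H be a graph, let C be a longest cycle in H with a fixed cyclic orientation, and let v be a vertex of H not on C. For a vertex w of C, let w⁻ and w⁺ denote the predecessor and successor of w along the orientation of C. Suppose w is a vertex of C such that w is not adjacent to v but both w⁻ and w⁺ are adjacent to v, and suppose u is a vertex of C adjacent to w in H with u ≠ w⁺. Then w u⁻ is not an edge of H, and the graph obtained from H by adding the edge w u⁻ contains a cycle strictly longer than C. -/
namespace SimpleGraph.Walk

variable {V : Type*} {G : SimpleGraph V}

/-- Two vertex-disjoint paths are closed up to a cycle by two further vertices, one at each
junction. -/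
theorem exists_isCycle_of_two_paths {a b d u v w : V} (p : G.Walk a d) (q : G.Walk u b)
    (hnd : (p.support ++ q.support ++ [w, v]).Nodup)
    (hdw : G.Adj d w) (hwu : G.Adj w u) (hbv : G.Adj b v) (hva : G.Adj v a) :
    ∃ c : G.Walk v v, c.IsCycle ∧ c.length = p.length + q.length + 4 := by
  refine ⟨cons hva (p.append (cons hdw (cons hwu (q.append (cons hbv nil))))), ?_, ?_⟩
  · rw [isCycle_iff_isPath_tail_and_le_length]
    refine ⟨?_, by simp; lia⟩
    rw [isPath_def]
    have hperm : (p.support ++ q.support ++ [w, v]).Perm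
        (p.support ++ w :: (q.support ++ [v])) := by
      rw [List.append_assoc]
      refine List.Perm.append_left _ ?_
      simp
    simpa [support_append] using hperm.nodup_iff.1 hnd
  · simp; lia

/-- In a cycle whose predecessor and successor functions are given, the successor function
moves one step along the walk as soon as it does so at the base point. -/
theorem IsCycle.nxt_getVert {w : V} {c : G.Walk w w} (hc : c.IsCycle) {nxt prv : V → V}
    (h : IsOrientation c nxt prv) (h0 : c.snd = nxt w) {i : ℕ} (hi : i < c.length) :
    nxt (c.getVert i) = c.getVert (i + 1) := by
  induction i with
  | zero => simpa using h0.symm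
  | succ i ih =>
    specialize ih (by lia)
    obtain ⟨-, -, hnxt, -, -, -, hne⟩ := h _ (c.getVert_mem_support (i + 1))
    obtain ⟨-, -, -, -, hprv, -, -⟩ := h _ (c.getVert_mem_support i)
    rw [ih] at hprv
    rw [← adj_toSubgraph_iff_mem_edges, ← Subgraph.mem_neighborSet,
      hc.neighborSet_toSubgraph_internal (by lia) hi] at hnxt
    rw [hprv] at hne
    simpa [hne] using hnxt

/-- A cycle with given successor function can be traversed starting at any vertex `w` and in
the direction of the successor function. -/
theorem IsCycle.exists_isCycle_snd_eq_nxt {x w : V} {c : G.Walk x x} (hc : c.IsCycle)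
    {nxt prv : V → V} (h : IsOrientation c nxt prv) (hw : w ∈ c.support) :
    ∃ q : G.Walk w w, q.IsCycle ∧ q.length = c.length ∧ (∀ z, z ∈ q.support ↔ z ∈ c.support) ∧
      IsOrientation q nxt prv ∧ q.snd = nxt w := by
  classical
  have hqc : (c.rotate w hw).IsCycle := hc.rotate hw
  have hs (z : V) : z ∈ (c.rotate w hw).support ↔ z ∈ c.support := mem_support_rotate_iff ..
  have he (e : Sym2 V) : e ∈ (c.rotate w hw).edges ↔ e ∈ c.edges :=
    (c.rotate_edges w hw).perm.mem_iff
  have hq : IsOrientation (c.rotate w hw) nxt prv := by simpa only [IsOrientation, hs, he] using h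
  have hl : (c.rotate w hw).length = c.length := length_rotate ..
  generalize c.rotate w hw = q at *
  have hn := (hq w q.start_mem_support).2.2.1
  rw [← adj_toSubgraph_iff_mem_edges, ← Subgraph.mem_neighborSet,
    hqc.neighborSet_toSubgraph_endpoint] at hn
  obtain hn | hn := hn
  · exact ⟨q, hqc, hl, hs, hq, hn.symm⟩
  · refine ⟨q.reverse, hqc.reverse, by simpa using hl, by simpa using hs, ?_, ?_⟩
    · simpa [IsOrientation] using hq
    · rw [snd_reverse]; exact hn.symm

/-- Splitting a path at an edge and at its final vertex. -/
theorem IsPath.nodup_take_append_dropLast_drop {a w v : V} {r : G.Walk a w} (hr : r.IsPath)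
    (hv : v ∉ r.support) {k : ℕ} (hk : k + 1 < r.length) :
    ((r.take k).support ++ (r.drop (k + 1)).dropLast.support ++ [w, v]).Nodup := by
  have hnil : ¬ (r.drop (k + 1)).Nil := by
    rw [not_nil_iff_lt_length, drop_length]; lia
  have hsplit : (r.take k).support ++ (r.drop (k + 1)).support = r.support := by
    rw [support_take, drop_support_eq_support_drop_min, min_eq_left hk.le, List.take_append_drop]
  have heq : (r.take k).support ++ (r.drop (k + 1)).dropLast.support ++ [w, v]
      = r.support ++ [v] := by
    rw [← hsplit, ← support_dropLast_concat hnil]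
    simp
  rw [heq, List.nodup_append]
  refine ⟨hr.support_nodup, by simp, ?_⟩
  rintro z hz _ hz' rfl
  simp_all

/-- If `v` lies off a cycle and is adjacent to both cycle neighbours of `w`, then replacing `w`
by `v` and inserting `w` between `prv u` and `u` gives a longer cycle. -/
theorem IsCycle.exists_longer {x : V} {c : G.Walk x x} (hc : c.IsCycle) {nxt prv : V → V}
    (h : IsOrientation c nxt prv) {u v w : V} (hv : v ∉ c.support) (hw : w ∈ c.support)
    (hprv : G.Adj v (prv w)) (hnxt : G.Adj v (nxt w)) (hu : u ∈ c.support) (hwu : G.Adj w u)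
    (hune : u ≠ nxt w) (hpu : G.Adj w (prv u)) :
    ∃ c' : G.Walk v v, c'.IsCycle ∧ c.length < c'.length := by
  obtain ⟨q, hq, hl, hs, ho, hsnd⟩ := hc.exists_isCycle_snd_eq_nxt h hw
  have hprv_getVert {i : ℕ} (hi : i < q.length) : prv (q.getVert (i + 1)) = q.getVert i := by
    rw [← hq.nxt_getVert ho hsnd hi]
    exact (ho _ (q.getVert_mem_support i)).2.2.2.2.1
  obtain ⟨i, rfl, hi⟩ := mem_support_iff_exists_getVert.1 ((hs u).2 hu)
  have hi0 : i ≠ 0 := by rintro rfl; simp at hwu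
  have hi1 : i ≠ 1 := by rintro rfl; exact hune hsnd
  have hin : i ≠ q.length := by rintro rfl; simp at hwu
  obtain ⟨k, rfl⟩ : ∃ k, i = k + 2 := ⟨i - 2, by lia⟩
  have htl : q.tail.length + 1 = q.length := length_tail_add_one hq.not_nil
  have hk : k + 1 < q.tail.length := by lia
  have hg (j : ℕ) : q.tail.getVert j = q.getVert (j + 1) := q.getVert_tail
  have hvt : v ∉ q.tail.support := fun hmem ↦ hv ((hs v).1 (by
    rw [support_tail_of_not_nil _ hq.not_nil] at hmem
    exact List.mem_of_mem_tail hmem))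
  have hpen : (q.tail.drop (k + 1)).penultimate = prv w := by
    have := hprv_getVert (i := q.length - 1) (by lia)
    rw [Nat.sub_add_cancel (by lia), getVert_length] at this
    rw [this, penultimate, drop_getVert, hg, drop_length]
    congr 1
    lia
  rw [hprv_getVert (by lia)] at hpu
  obtain ⟨c', hc', hlen⟩ := exists_isCycle_of_two_paths (q.tail.take k)
    (q.tail.drop (k + 1)).dropLast (hq.isPath_tail.nodup_take_append_dropLast_drop hvt hk)
    (by rw [hg]; exact hpu.symm) (by rw [hg]; exact hwu) (by rw [hpen]; exact hprv.symm)
    (by rw [hsnd]; exact hnxt)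
  refine ⟨c', hc', ?_⟩
  rw [hlen, take_length, length_dropLast, drop_length]
  lia

end SimpleGraph.Walk

/-- Let `H` be a graph, let `C` be a longest cycle in `H` with a fixed
cyclic orientation, and let `v` be a vertex of `H` not on `C`. Suppose `w` is a vertex of `C`
not adjacent to `v` such that both `w⁻` and `w⁺` are adjacent to `v`, and suppose `u` is a
vertex of `C` adjacent to `w` in `H` with `u ≠ w⁺`. Then `w u⁻` is not an edge of `H`, and
`H + w u⁻` contains a cycle strictly longer than `C`. -/
theorem statement15 {V : Type*}
    (H : SimpleGraph V)
    (x : V) (c : H.Walk x x) (hc : c.IsCycle)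
    (hlongest : ∀ (y : V) (c' : H.Walk y y), c'.IsCycle → c'.length ≤ c.length)
    (nxt prv : V → V) (horient : IsOrientation c nxt prv)
    (v : V) (hv : v ∉ c.support)
    (w : V) (hw : w ∈ c.support)
    (hwv : ¬ H.Adj v w) (hprv : H.Adj v (prv w)) (hnxt : H.Adj v (nxt w))
    (u : V) (hu : u ∈ c.support) (hadj : H.Adj w u) (hune : u ≠ nxt w) :
    s(w, prv u) ∉ H.edgeSet ∧
      ∃ (y : V) (c' : (H ⊔ SimpleGraph.fromEdgeSet {s(w, prv u)}).Walk y y),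
        c'.IsCycle ∧ c.length < c'.length := by
  have hpu_ne : w ≠ prv u := by
    rintro rfl
    exact hune (horient u hu).2.2.2.2.2.1.symm
  constructor
  · intro hpu
    obtain ⟨c', hc', hlt⟩ := hc.exists_longer horient hv hw hprv hnxt hu hadj hune hpu
    exact (hlongest v c' hc').not_gt hlt
  · have hle : H ≤ H ⊔ SimpleGraph.fromEdgeSet {s(w, prv u)} := le_sup_left
    have horient' : IsOrientation (c.mapLe hle) nxt prv := by
      simpa [IsOrientation] using horient
    obtain ⟨c', hc', hlt⟩ := (hc.mapLe hle).exists_longer horient' (by simpa using hv)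
      (by simpa using hw) (hle hprv) (hle hnxt) (by simpa using hu) (hle hadj) hune
      (by simp [hpu_ne])
    exact ⟨v, c', hc', by simpa using hlt⟩
end

section
/- Let H be a graph, let M be a matching of maximum size in H, and let u and v be two distinct vertices of H not covered by M. Suppose x and y are two distinct vertices covered by M, let x' denote the vertex matched to x by M and y' the vertex matched to y by M, and suppose x' is adjacent to u and y' is adjacent to v in H. Then xy is not an edge of H. -/
namespace SimpleGraph.Subgraph

variable {V : Type*} {H : SimpleGraph V} {M : H.Subgraph}

/-- Adding an edge between two uncovered vertices to a matching gives a matching. -/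
theorem IsMatching.sup_subgraphOfAdj (hM : M.IsMatching) {a b : V} (hab : H.Adj a b)
    (ha : a ∉ M.verts) (hb : b ∉ M.verts) : (M ⊔ H.subgraphOfAdj hab).IsMatching := by
  refine hM.sup (IsMatching.subgraphOfAdj hab) ?_
  rw [hM.support_eq_verts, (IsMatching.subgraphOfAdj hab).support_eq_verts, Set.disjoint_right]
  rintro w (rfl | rfl)
  · exact ha
  · exact hb

theorem ncard_edgeSet_sup_subgraphOfAdj [Finite V] {a b : V} (hab : H.Adj a b)
    (ha : a ∉ M.verts) :
    (M ⊔ H.subgraphOfAdj hab).edgeSet.ncard = M.edgeSet.ncard + 1 := by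
  rw [edgeSet_sup, edgeSet_subgraphOfAdj, Set.union_singleton,
    Set.ncard_insert_of_notMem fun h => ha (M.edge_vert (Subgraph.mem_edgeSet.mp h))]

/-- Removing the endpoints of an edge of a matching gives a matching. -/
theorem IsMatching.deleteVerts_pair (hM : M.IsMatching) {a b : V} (hab : M.Adj a b) :
    (M.deleteVerts {a, b}).IsMatching := by
  rintro w ⟨hw, hw'⟩
  obtain ⟨z, hz, hz_unique⟩ := hM hw
  refine ⟨z, ?_, fun t ht => hz_unique t (deleteVerts_adj.mp ht).2.2.2.2⟩
  refine deleteVerts_adj.mpr ⟨hw, hw', M.edge_vert hz.symm, ?_, hz⟩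
  rintro (rfl | rfl)
  · exact hw' (Or.inr (hM.eq_of_adj_left hab hz.symm).symm)
  · exact hw' (Or.inl (hM.eq_of_adj_left hab.symm hz.symm).symm)

theorem IsMatching.ncard_edgeSet_deleteVerts_pair [Finite V] (hM : M.IsMatching) {a b : V}
    (hab : M.Adj a b) : (M.deleteVerts {a, b}).edgeSet.ncard + 1 = M.edgeSet.ncard := by
  have hnot : s(a, b) ∉ (M.deleteVerts {a, b}).edgeSet := fun h =>
    (deleteVerts_adj.mp (Subgraph.mem_edgeSet.mp h)).2.1 (Or.inl rfl)
  rw [← Set.ncard_insert_of_notMem hnot]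
  congr 1
  ext e
  induction e with | _ w z
  simp only [Set.mem_insert_iff, Subgraph.mem_edgeSet, deleteVerts_adj, Set.mem_singleton_iff,
    Sym2.eq_iff]
  constructor
  · rintro ((⟨rfl, rfl⟩ | ⟨rfl, rfl⟩) | h)
    · exact hab
    · exact hab.symm
    · exact h.2.2.2.2
  · intro h
    have h1 := M.edge_vert h
    have h2 := M.edge_vert h.symm
    have h3 : w = a → z = b := by rintro rfl; exact hM.eq_of_adj_left h hab
    have h4 : w = b → z = a := by rintro rfl; exact hM.eq_of_adj_left h hab.symm
    have h5 : z = a → w = b := by rintro rfl; exact hM.eq_of_adj_left h.symm hab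
    have h6 : z = b → w = a := by rintro rfl; exact hM.eq_of_adj_left h.symm hab.symm
    tauto

/-- Replacing the edge `ab` of a matching by an edge from `b` to an uncovered vertex `c` gives a
matching of the same size, which covers `c` instead of `a` and keeps the other edges. -/
theorem IsMatching.exists_exchange [Finite V] (hM : M.IsMatching) {a b c : V}
    (hab : M.Adj a b) (hbc : H.Adj b c) (hc : c ∉ M.verts) :
    ∃ N : H.Subgraph, N.IsMatching ∧ N.edgeSet.ncard = M.edgeSet.ncard ∧ a ∉ N.verts ∧
      (∀ w, w ∉ M.verts → w ≠ c → w ∉ N.verts) ∧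
      ∀ w z, M.Adj w z → w ≠ a → w ≠ b → N.Adj w z := by
  have hb' : b ∉ (M.deleteVerts {a, b}).verts := fun h => h.2 (Or.inr rfl)
  have hc' : c ∉ (M.deleteVerts {a, b}).verts := fun h => hc h.1
  have ha : a ∈ M.verts := M.edge_vert hab
  have hb : b ∈ M.verts := M.edge_vert hab.symm
  refine ⟨M.deleteVerts {a, b} ⊔ H.subgraphOfAdj hbc,
    (hM.deleteVerts_pair hab).sup_subgraphOfAdj hbc hb' hc', ?_, ?_, ?_, ?_⟩
  · rw [ncard_edgeSet_sup_subgraphOfAdj hbc hb', hM.ncard_edgeSet_deleteVerts_pair hab]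
  · rintro (h | h | h)
    · exact h.2 (Or.inl rfl)
    · exact hab.ne h
    · exact hc (h ▸ ha)
  · rintro w hw hwc (h | h | h)
    · exact hw h.1
    · exact hw (h ▸ hb)
    · exact hwc h
  · intro w z hwz hwa hwb
    refine Or.inl (deleteVerts_adj.mpr ⟨M.edge_vert hwz, ?_, M.edge_vert hwz.symm, ?_, hwz⟩)
    · rintro (h | h)
      · exact hwa h
      · exact hwb h
    · rintro (rfl | rfl)
      · exact hwb (hM.eq_of_adj_left hwz.symm hab)
      · exact hwa (hM.eq_of_adj_left hwz.symm hab.symm)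

/-- An edge between two uncovered vertices makes a matching non-maximum. -/
theorem IsMatching.exists_ncard_edgeSet_lt [Finite V] (hM : M.IsMatching) {a b : V}
    (hab : H.Adj a b) (ha : a ∉ M.verts) (hb : b ∉ M.verts) :
    ∃ N : H.Subgraph, N.IsMatching ∧ M.edgeSet.ncard < N.edgeSet.ncard :=
  ⟨_, hM.sup_subgraphOfAdj hab ha hb, by
    rw [ncard_edgeSet_sup_subgraphOfAdj hab ha]; exact Nat.lt_succ_self _⟩

end SimpleGraph.Subgraph


/-- Let `H` be a graph, let `M` be a matching of maximum size in `H`, and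
let `u` and `v` be two distinct vertices of `H` not covered by `M`. Suppose `x` and `y` are
two distinct vertices covered by `M`, with `x'` matched to `x` and `y'` matched to `y`, and
suppose `x'` is adjacent to `u` and `y'` is adjacent to `v` in `H`. Then `xy` is not an edge
of `H`. -/
theorem statement16 {V : Type*} [Fintype V]
    (H : SimpleGraph V)
    (M : H.Subgraph) (hM : M.IsMatching)
    (hmax : ∀ M' : H.Subgraph, M'.IsMatching → M'.edgeSet.ncard ≤ M.edgeSet.ncard)
    (u v : V) (hu : u ∉ M.verts) (hv : v ∉ M.verts) (huv : u ≠ v)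
    (x y x' y' : V) (hxy : x ≠ y)
    (hx' : M.Adj x x') (hy' : M.Adj y y')
    (hx'u : H.Adj x' u) (hy'v : H.Adj y' v) :
    ¬ H.Adj x y := by
  intro hxyH
  obtain ⟨N, hN, hNcard, hxN, hNfree, hNadj⟩ := hM.exists_exchange hx' hx'u hu
  have hvN : v ∉ N.verts := hNfree v hv huv.symm
  by_cases hyx' : y = x'
  · subst hyx'
    obtain rfl : y' = x := hM.eq_of_adj_left hy' hx'.symm
    obtain ⟨K, hK, hlt⟩ := hN.exists_ncard_edgeSet_lt hy'v hxN hvN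
    have := hmax K hK
    omega
  · obtain ⟨L, hL, hLcard, hyL, hLfree, -⟩ :=
      hN.exists_exchange (hNadj y y' hy' hxy.symm hyx') hy'v hvN
    have hxv : x ≠ v := fun h => hv (h ▸ M.edge_vert hx')
    obtain ⟨K, hK, hlt⟩ := hL.exists_ncard_edgeSet_lt hxyH (hLfree x hxN hxv) hyL
    have := hmax K hK
    omega
end

section
/- Any 2-connected graph G on n vertices with minimum degree δ(G) = d, where 1 < d ≤ n/2, contains a cycle of length at least 2d. -/
namespace SimpleGraph

variable {V : Type*} {G : SimpleGraph V}

/-- There is a path from `x` to `y` in `G` whose vertex set is `S`. -/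
def HasPathOn (G : SimpleGraph V) (x y : V) (S : Set V) : Prop :=
  ∃ p : G.Walk x y, p.IsPath ∧ ∀ v, v ∈ S ↔ v ∈ p.support

namespace HasPathOn

variable {x y z w : V} {S T : Set V}

lemma left_mem (h : G.HasPathOn x y S) : x ∈ S := by
  obtain ⟨p, -, hS⟩ := h
  exact (hS x).2 p.start_mem_support

lemma right_mem (h : G.HasPathOn x y S) : y ∈ S := by
  obtain ⟨p, -, hS⟩ := h
  exact (hS y).2 p.end_mem_support

lemma symm (h : G.HasPathOn x y S) : G.HasPathOn y x S := by
  obtain ⟨p, hp, hS⟩ := h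
  exact ⟨p.reverse, hp.reverse, by simpa using hS⟩

lemma singleton (x : V) : G.HasPathOn x x {x} := ⟨.nil, by simp, by simp⟩

lemma append (h₁ : G.HasPathOn x y S) (h₂ : G.HasPathOn y z T) (hST : S ∩ T ⊆ {y}) :
    G.HasPathOn x z (S ∪ T) := by
  obtain ⟨p, hp, hS⟩ := h₁
  obtain ⟨q, hq, hT⟩ := h₂
  refine ⟨p.append q, ?_, fun v ↦ ?_⟩
  · rw [Walk.isPath_def, Walk.support_append, List.nodup_append]
    refine ⟨hp.support_nodup, hq.support_nodup.tail, fun a ha b hb hab ↦ ?_⟩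
    subst hab
    have hay : a = y := hST ⟨(hS a).2 ha, (hT a).2 (List.mem_of_mem_tail hb)⟩
    subst hay
    have := hq.support_nodup
    rw [← Walk.cons_tail_support] at this
    exact (List.nodup_cons.1 this).1 hb
  · rw [Walk.mem_support_append_iff, ← hS, ← hT]; rfl

lemma cons (h : G.HasPathOn y z S) (hxy : G.Adj x y) (hx : x ∉ S) :
    G.HasPathOn x z (insert x S) := by
  obtain ⟨p, hp, hS⟩ := h
  exact ⟨.cons hxy p, hp.cons (by rwa [← hS]), fun v ↦ by simp [hS]⟩

lemma concat (h : G.HasPathOn x y S) (hyz : G.Adj y z) (hz : z ∉ S) :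
    G.HasPathOn x z (insert z S) :=
  (h.symm.cons hyz.symm hz).symm

lemma append_adj (h₁ : G.HasPathOn x y S) (h₂ : G.HasPathOn z w T) (hyz : G.Adj y z)
    (hST : Disjoint S T) : G.HasPathOn x w (S ∪ T) := by
  have hy : y ∉ T := Set.disjoint_left.1 hST h₁.right_mem
  have := h₁.append (h₂.cons hyz hy) (by
    rintro a ⟨haS, rfl | haT⟩
    · rfl
    · exact (Set.disjoint_left.1 hST haS haT).elim)
  rwa [Set.union_insert, Set.insert_eq_of_mem (Set.mem_union_left T h₁.right_mem)] at this

lemma split (h : G.HasPathOn x y S) (hw : w ∈ S) :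
    ∃ S₁ S₂, G.HasPathOn x w S₁ ∧ G.HasPathOn w y S₂ ∧ S₁ ∪ S₂ = S ∧ S₁ ∩ S₂ = {w} := by
  classical
  obtain ⟨p, hp, hS⟩ := h
  have hw' := (hS w).1 hw
  refine ⟨{v | v ∈ (p.takeUntil w hw').support}, {v | v ∈ (p.dropUntil w hw').support},
    ⟨_, hp.takeUntil hw', fun v ↦ Iff.rfl⟩, ⟨_, hp.dropUntil hw', fun v ↦ Iff.rfl⟩, ?_, ?_⟩
  · ext v
    rw [hS]
    conv_rhs => rw [← p.take_spec hw', Walk.mem_support_append_iff]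
    rfl
  · ext v
    constructor
    · rintro ⟨h₁, h₂⟩
      have hn := hp.support_nodup
      rw [← p.take_spec hw', Walk.support_append, List.nodup_append] at hn
      by_contra hv
      refine hn.2.2 v h₁ v ?_ rfl
      have h₂ : v ∈ (p.dropUntil w hw').support := h₂
      rw [← Walk.cons_tail_support] at h₂
      exact (List.mem_cons.1 h₂).resolve_left hv
    · rintro rfl
      exact ⟨Walk.end_mem_support _, Walk.start_mem_support _⟩

lemma exists_tail (h : G.HasPathOn x y S) (hxy : x ≠ y) :
    ∃ z, G.Adj x z ∧ G.HasPathOn z y (S \ {x}) := by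
  obtain ⟨p, hp, hS⟩ := h
  cases p with
  | nil => exact (hxy rfl).elim
  | cons hadj q =>
    rw [Walk.cons_isPath_iff] at hp
    refine ⟨_, hadj, q, hp.1, fun v ↦ ?_⟩
    rw [Set.mem_sdiff, hS, Walk.support_cons, List.mem_cons, Set.mem_singleton_iff]
    have : v ∈ q.support → v ≠ x := fun h h' ↦ hp.2 (h' ▸ h)
    tauto

lemma finite (h : G.HasPathOn x y S) : S.Finite := by
  obtain ⟨p, hp, hS⟩ := h
  exact (List.finite_toSet p.support).subset fun v hv ↦ (hS v).1 hv

lemma ncard_eq (h : G.HasPathOn x y S) :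
    ∃ p : G.Walk x y, p.IsPath ∧ S.ncard = p.length + 1 := by
  classical
  obtain ⟨p, hp, hS⟩ := h
  refine ⟨p, hp, ?_⟩
  have : S = (p.support.toFinset : Set V) := by ext v; simp [hS]
  rw [this, Set.ncard_coe_finset, List.toFinset_card_of_nodup hp.support_nodup,
    Walk.length_support]

/-- Closing up a path on at least three vertices. -/
lemma exists_isCycle (h : G.HasPathOn x y S) (hxy : G.Adj x y) (hS : 3 ≤ S.ncard) :
    ∃ (v : V) (c : G.Walk v v), c.IsCycle ∧ c.length = S.ncard := by
  obtain ⟨p, hp, hc⟩ := h.ncard_eq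
  refine ⟨y, .cons hxy.symm p, ?_, by simp [hc]⟩
  rw [Walk.cons_isCycle_iff]
  refine ⟨hp, fun he ↦ ?_⟩
  have := hp.length_eq_one_of_mem_edges (Sym2.eq_swap ▸ he)
  omega

/-- Two internally disjoint paths with common ends form a cycle. -/
lemma exists_isCycle_union (h₁ : G.HasPathOn x y S) (h₂ : G.HasPathOn x y T) (hxy : x ≠ y)
    (hST : S ∩ T ⊆ {x, y}) (hc : 3 ≤ (S ∪ T).ncard) :
    ∃ (v : V) (c : G.Walk v v), c.IsCycle ∧ c.length = (S ∪ T).ncard := by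
  obtain ⟨z, hz, h₃⟩ := h₂.exists_tail hxy
  have hU : S ∪ T \ {x} = S ∪ T := by
    ext a
    have := h₁.left_mem
    by_cases a = x <;> grind
  have := h₁.append h₃.symm (by grind)
  rw [hU] at this
  exact this.exists_isCycle hz hc

/-- A path whose ends are adjacent can be rotated to start at any of its vertices. -/
lemma exists_rotate (h : G.HasPathOn x y S) (hxy : G.Adj x y) (hw : w ∈ S) :
    ∃ z, G.HasPathOn w z S := by
  by_cases hwy : w = y
  · exact ⟨x, hwy ▸ h.symm⟩
  obtain ⟨S₁, S₂, h₁, h₂, hU, hI⟩ := h.split hw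
  obtain ⟨z, hz, h₃⟩ := h₂.exists_tail hwy
  refine ⟨z, ?_⟩
  have := h₁.symm.append_adj h₃.symm hxy (by rw [Set.disjoint_left]; grind)
  convert this using 1
  have := h₁.right_mem
  grind

end HasPathOn

/-- If deleting `z` leaves `G` connected, then any two sets meeting the rest are joined by a path
avoiding `z` that meets each of them only in its respective end. -/
lemma exists_hasPathOn_between {z x y : V} {X Y : Set V}
    (h : (G.induce {u | u ≠ z}).Connected) (hx : x ∈ X) (hxz : x ≠ z) (hy : y ∈ Y) (hyz : y ≠ z) :
    ∃ x ∈ X, ∃ y ∈ Y, ∃ S, G.HasPathOn x y S ∧ z ∉ S ∧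
      (∀ v ∈ S, v ∈ X → v = x) ∧ (∀ v ∈ S, v ∈ Y → v = y) := by
  have start : ∃ S, G.HasPathOn x y S ∧ z ∉ S := by
    obtain ⟨p, hp⟩ := h.exists_isPath ⟨x, hxz⟩ ⟨y, hyz⟩
    refine ⟨_, ⟨p.map (Embedding.induce _).toHom,
      hp.map (Embedding.induce (G := G) _).injective, fun v ↦ Set.mem_ofPred⟩, ?_⟩
    change z ∉ (p.map (Embedding.induce (G := G) {u | u ≠ z}).toHom).support
    rw [Walk.support_map, List.mem_map]
    rintro ⟨⟨a, ha⟩, -, haz⟩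
    exact ha haz
  obtain ⟨S, hS, hzS⟩ := start
  clear hxz hyz
  induction hn : S.ncard using Nat.strong_induction_on generalizing x y S with
  | _ n ih =>
  by_cases h₁ : ∀ v ∈ S, v ∈ X → v = x
  · by_cases h₂ : ∀ v ∈ S, v ∈ Y → v = y
    · exact ⟨x, hx, y, hy, S, hS, hzS, h₁, h₂⟩
    · push Not at h₂
      obtain ⟨w, hwS, hwY, hwy⟩ := h₂
      obtain ⟨S₁, S₂, hS₁, hS₂, hU, hI⟩ := hS.split hwS
      have hy₁ : y ∉ S₁ := fun hy₁ ↦ hwy (hI.subset ⟨hy₁, hS₂.right_mem⟩).symm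
      have hlt : S₁ ⊂ S := ⟨by grind, fun hle ↦ hy₁ (hle hS.right_mem)⟩
      exact ih _ (hn ▸ Set.ncard_lt_ncard hlt hS.finite) hx hwY S₁ hS₁ (by grind) rfl
  · push Not at h₁
    obtain ⟨w, hwS, hwX, hwx⟩ := h₁
    obtain ⟨S₁, S₂, hS₁, hS₂, hU, hI⟩ := hS.split hwS
    have hx₂ : x ∉ S₂ := fun hx₂ ↦ hwx (hI.subset ⟨hS₁.left_mem, hx₂⟩).symm
    have hlt : S₂ ⊂ S := ⟨by grind, fun hle ↦ hx₂ (hle hS.left_mem)⟩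
    exact ih _ (hn ▸ Set.ncard_lt_ncard hlt hS.finite) hwX hy S₂ hS₂ (by grind) rfl

/-- The sequence `v 0, …, v m` is a path in `G`. -/
structure IsPathSeq (G : SimpleGraph V) (v : ℕ → V) (m : ℕ) : Prop where
  adj : ∀ i < m, G.Adj (v i) (v (i + 1))
  inj : ∀ i ≤ m, ∀ j ≤ m, v i = v j → i = j

lemma HasPathOn.exists_isPathSeq {x y : V} {S : Set V} (h : G.HasPathOn x y S) :
    ∃ v m, G.IsPathSeq v m ∧ v 0 = x ∧ v m = y ∧ S = v '' Set.Iic m := by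
  obtain ⟨p, hp, hS⟩ := h
  refine ⟨p.getVert, p.length, ⟨fun i hi ↦ p.adj_getVert_succ hi,
    fun i hi j hj hij ↦ hp.getVert_injOn hi hj hij⟩, by simp, by simp, ?_⟩
  ext a
  rw [hS, Walk.mem_support_iff_exists_getVert]
  simp [and_comm]

namespace IsPathSeq

variable {v : ℕ → V} {m : ℕ}

lemma shift (hv : G.IsPathSeq v m) (s : ℕ) :
    G.IsPathSeq (fun i ↦ v (s + i)) (m - s) where
  adj i hi := hv.adj (s + i) (by omega)
  inj i hi j hj hij := by
    by_cases hs : s ≤ m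
    · have := hv.inj _ (by omega) _ (by omega) hij
      omega
    · omega

lemma reverse (hv : G.IsPathSeq v m) : G.IsPathSeq (fun i ↦ v (m - i)) m where
  adj i hi := by
    have := (hv.adj (m - (i + 1)) (by omega)).symm
    rwa [show m - (i + 1) + 1 = m - i by omega] at this
  inj i hi j hj hij := by
    have := hv.inj _ (by omega) _ (by omega) hij
    omega

lemma mem_image_iff (hv : G.IsPathSeq v m) {I : Set ℕ} (hI : ∀ i ∈ I, i ≤ m) {k : ℕ}
    (hk : k ≤ m) : v k ∈ v '' I ↔ k ∈ I := by
  refine ⟨?_, fun h ↦ ⟨k, h, rfl⟩⟩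
  rintro ⟨i, hi, h⟩
  exact hv.inj _ (hI i hi) _ hk h ▸ hi

lemma disjoint_image (hv : G.IsPathSeq v m) {I J : Set ℕ} (hI : ∀ i ∈ I, i ≤ m)
    (hJ : ∀ i ∈ J, i ≤ m) (hIJ : Disjoint I J) : Disjoint (v '' I) (v '' J) := by
  rw [Set.disjoint_left]
  rintro _ ⟨i, hi, rfl⟩ h
  exact Set.disjoint_left.1 hIJ hi ((hv.mem_image_iff hJ (hI i hi)).1 h)

lemma hasPathOn (hv : G.IsPathSeq v m) {i j : ℕ} (hij : i ≤ j) (hj : j ≤ m) :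
    G.HasPathOn (v i) (v j) (v '' Set.Icc i j) := by
  induction j, hij using Nat.le_induction with
  | base => simpa using HasPathOn.singleton (v i)
  | succ j hij ih =>
    have h := (ih (by omega)).concat (hv.adj j (by omega)) (by
      rw [hv.mem_image_iff (by simp; omega) hj]
      simp)
    rwa [← Set.image_insert_eq,
      show insert (j + 1) (Set.Icc i j) = Set.Icc i (j + 1) by ext; simp; omega] at h

/-- Joining the ends of an initial and a final segment of a path by the edge between the far
end of the path and the initial segment. -/
lemma hasPathOn_of_adj (hv : G.IsPathSeq v m) {i j s : ℕ} (hij : i < j) (hjs : j ≤ s)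
    (hs : s ≤ m) (h : G.Adj (v 0) (v j)) :
    G.HasPathOn (v i) (v s) (v '' (Set.Icc 0 i ∪ Set.Icc j s)) := by
  rw [Set.image_union]
  refine (hv.hasPathOn i.zero_le (by omega)).symm.append_adj (hv.hasPathOn hjs hs) h ?_
  refine hv.disjoint_image (by simp; omega) (by simp; omega) ?_
  rw [Set.disjoint_left]
  simp
  omega

/-- A path from `v a` to `v s` inside an initial segment of a path through all neighbours of
`v 0` in that segment. -/
lemma exists_hasPathOn_neighbors (hv : G.IsPathSeq v m) {a s : ℕ} (has : a < s) (hs : s ≤ m)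
    (h : G.Adj (v 0) (v s)) :
    ∃ S ⊆ v '' Set.Icc 0 s, G.HasPathOn (v a) (v s) S ∧
      ∀ k ≤ s, k = 0 ∨ G.Adj (v 0) (v k) → v k ∈ S := by
  classical
  have hex : ∃ j, a < j ∧ G.Adj (v 0) (v j) := ⟨s, has, h⟩
  obtain ⟨haj, hj⟩ := Nat.find_spec hex
  have hmin : ∀ k, a < k → G.Adj (v 0) (v k) → Nat.find hex ≤ k :=
    fun k hk hk' ↦ Nat.find_min' hex ⟨hk, hk'⟩
  refine ⟨_, Set.image_mono ?_, hv.hasPathOn_of_adj haj (hmin s has h) hs hj, fun k hk hk' ↦ ?_⟩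
  · intro i
    simp
    omega
  · refine ⟨k, ?_, rfl⟩
    have := hmin k
    simp
    grind

/-- The same with the two ends given as points of the segment one of which is `v s`. -/
lemma exists_hasPathOn_neighbors' (hv : G.IsPathSeq v m) {s : ℕ} (hs : s ≤ m)
    (h : G.Adj (v 0) (v s)) {x y : V} (hx : x ∈ v '' Set.Icc 0 s) (hy : y ∈ v '' Set.Icc 0 s)
    (hxy : x ≠ y) (hxs : v s = x ∨ v s = y) :
    ∃ S ⊆ v '' Set.Icc 0 s, G.HasPathOn x y S ∧
      ∀ k ≤ s, k = 0 ∨ G.Adj (v 0) (v k) → v k ∈ S := by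
  obtain ⟨i, hi, rfl⟩ := hx
  obtain ⟨j, hj, rfl⟩ := hy
  rcases hxs with hxs | hxs
  · rw [← hxs] at hxy ⊢
    have hjs : j ≠ s := by rintro rfl; exact hxy rfl
    obtain ⟨S, hS, h₁, h₂⟩ := hv.exists_hasPathOn_neighbors (lt_of_le_of_ne hj.2 hjs) hs h
    exact ⟨S, hS, h₁.symm, h₂⟩
  · rw [← hxs] at hxy ⊢
    have his : i ≠ s := by rintro rfl; exact hxy rfl
    exact hv.exists_hasPathOn_neighbors (lt_of_le_of_ne hi.2 his) hs h

end IsPathSeq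

/-- Two disjoint paths from a set `A` to a path `q 0, …, q m` starting in `A`, one of them
starting at `q 0` and one of them ending at the prescribed vertex `q t`. -/
lemma exists_linkage (h : ∀ z, (G.induce {u | u ≠ z}).Connected) {q : ℕ → V} {m : ℕ}
    (hq : G.IsPathSeq q m) {A : Set V} (hqA : q 0 ∈ A) (hA : ∀ i ≤ m, q i ∈ A → i = 0)
    {a : V} (ha : a ∈ A) (haq : a ≠ q 0) {t : ℕ} (ht : t < m) :
    ∃ x ∈ A, ∃ y ∈ A, ∃ b, ∃ R₁ R₂ : Set V, (q 0 = x ∨ q 0 = y) ∧ t < b ∧ b ≤ m ∧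
      G.HasPathOn x (q t) R₁ ∧ G.HasPathOn y (q b) R₂ ∧ Disjoint R₁ R₂ ∧
      (∀ v ∈ R₁, v ∈ A → v = x) ∧ (∀ v ∈ R₂, v ∈ A → v = y) ∧
      (∀ i, t ≤ i → i ≤ m → q i ∈ R₁ → i = t) ∧ (∀ i, t ≤ i → i ≤ m → q i ∈ R₂ → i = b) := by
  induction t with
  | zero =>
    obtain ⟨y, hy, _, ⟨b, hb, rfl⟩, S, hS, hzS, hSA, hSq⟩ :=
      exists_hasPathOn_between (h (q 0)) (X := A) (Y := q '' Set.Icc 1 m) ha haq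
        ⟨1, ⟨le_rfl, ht⟩, rfl⟩ (fun h ↦ by have := hq.inj 1 ht 0 (by omega) h; omega)
    refine ⟨q 0, hqA, y, hy, b, {q 0}, S, .inl rfl, hb.1, hb.2, .singleton _, hS, by simpa,
      fun v hv _ ↦ hv, hSA, fun i _ hi h ↦ hq.inj _ hi _ (by omega) h, fun i _ hi h ↦ ?_⟩
    have hi0 : i ≠ 0 := by rintro rfl; exact hzS h
    exact hq.inj _ hi _ hb.2 (hSq _ h ⟨i, ⟨by omega, hi⟩, rfl⟩)
  | succ t ih =>
    obtain ⟨x, hx, y, hy, b, R₁, R₂, hxy, htb, hbm, h₁, h₂, hd, hA₁, hA₂, hq₁, hq₂⟩ :=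
      ih (by omega)
    rw [Set.disjoint_left] at hd
    have hadj := hq.adj t (by omega)
    have ht₁ : q (t + 1) ∉ R₁ := fun h ↦ by have := hq₁ _ (by omega) (by omega) h; omega
    have htA : q (t + 1) ∉ A := fun h ↦ by have := hA _ (by omega) h; omega
    have hc := h₁.concat hadj ht₁
    have hcq : ∀ i, t + 1 ≤ i → i ≤ m → q i ∈ insert (q (t + 1)) R₁ → i = t + 1 := by
      rintro i hi him (h | h)
      · exact hq.inj _ him _ (by omega) h
      · have := hq₁ i (by omega) him h
        omega
    have hcA : ∀ v ∈ insert (q (t + 1)) R₁, v ∈ A → v = x := by grind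
    by_cases hb : t + 1 < b
    · refine ⟨x, hx, y, hy, b, _, R₂, hxy, hb, hbm, hc, h₂, ?_, hcA, hA₂, hcq,
        fun i hi ↦ hq₂ i (by omega)⟩
      rw [Set.disjoint_left]
      rintro v (rfl | hv) hv'
      · have := hq₂ _ (by omega) (by omega) hv'
        omega
      · exact hd hv hv'
    · obtain rfl : b = t + 1 := by omega
      obtain ⟨w, hw, _, ⟨c, hc', rfl⟩, S, hS, hzS, hSX, hSq⟩ :=
        exists_hasPathOn_between (h (q (t + 1))) (X := A ∪ R₁ ∪ R₂) (Y := q '' Set.Icc (t + 2) m)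
          (x := x) (y := q (t + 2)) (.inl (.inl hx)) (by rintro rfl; exact htA hx)
          ⟨t + 2, ⟨le_rfl, ht⟩, rfl⟩
          (fun h ↦ by have := hq.inj _ (by omega) _ (by omega) h; omega)
      have hSc : ∀ i, t + 1 ≤ i → i ≤ m → q i ∈ S → i = c := fun i hi him hiS ↦ by
        have : i ≠ t + 1 := by rintro rfl; exact hzS hiS
        exact hq.inj _ him _ hc'.2 (hSq _ hiS ⟨i, ⟨by omega, him⟩, rfl⟩)
      have hwS := hS.left_mem
      by_cases hw₁ : w ∈ R₁
      · obtain ⟨P, P', hP, -, hU, -⟩ := h₁.split hw₁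
        have hPR : ∀ v ∈ P, v ∈ R₁ := by grind
        refine ⟨y, hy, x, hx, c, R₂, P ∪ S, hxy.symm, hc'.1, hc'.2, h₂, hP.append hS ?_, ?_, hA₂,
          ?_, fun i hi ↦ hq₂ i (by omega), ?_⟩
        · grind
        · rw [Set.disjoint_left]; grind
        · grind
        · rintro i hi him (hv | hv)
          · have := hq₁ i (by omega) him (hPR _ hv)
            omega
          · exact hSc i hi him hv
      by_cases hw₂ : w ∈ R₂
      · obtain ⟨P, P', hP, hP', hU, hI⟩ := h₂.split hw₂
        have hPR : ∀ v ∈ P, v ∈ R₂ := by grind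
        have htP : q (t + 1) ∉ P := fun h ↦ by
          have : q (t + 1) ∈ P ∩ P' := ⟨h, hP'.right_mem⟩
          rw [hI] at this
          exact hzS (this ▸ hwS)
        refine ⟨x, hx, y, hy, c, _, P ∪ S, hxy, hc'.1, hc'.2, hc, hP.append hS ?_, ?_, hcA,
          ?_, hcq, ?_⟩
        · grind
        · rw [Set.disjoint_left]; grind
        · grind
        · rintro i hi him (hv | hv)
          · have := hq₂ i (by omega) him (hPR _ hv)
            subst this
            exact (htP hv).elim
          · exact hSc i hi him hv
      have hwA : w ∈ A := by grind
      rcases hxy with hxy | hxy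
      · refine ⟨x, hx, w, hwA, c, _, S, .inl hxy, hc'.1, hc'.2, hc, hS, ?_, hcA, ?_, hcq, hSc⟩
        · rw [Set.disjoint_left]; grind
        · grind
      · refine ⟨y, hy, w, hwA, c, R₂, S, .inl hxy, hc'.1, hc'.2, h₂, hS, ?_, hA₂, ?_,
          fun i hi ↦ hq₂ i (by omega), hSc⟩
        · rw [Set.disjoint_left]; grind
        · grind

section Longest

variable [Finite V] {x y : V} {S : Set V}

lemma exists_longest_hasPathOn (G : SimpleGraph V) [Nonempty V] :
    ∃ x y S, G.HasPathOn x y S ∧ ∀ x' y' S', G.HasPathOn x' y' S' → S'.ncard ≤ S.ncard := by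
  obtain ⟨S, ⟨x, y, h⟩, hS⟩ := Set.exists_max_image {S | ∃ x y, G.HasPathOn x y S} Set.ncard
    (Set.toFinite _) ⟨_, _, _, .singleton (Classical.arbitrary V)⟩
  exact ⟨x, y, S, h, fun x' y' S' h' ↦ hS S' ⟨x', y', h'⟩⟩

lemma HasPathOn.mem_of_adj_of_longest (h : G.HasPathOn x y S)
    (hmax : ∀ x' y' S', G.HasPathOn x' y' S' → S'.ncard ≤ S.ncard) {w : V} (hw : G.Adj x w) :
    w ∈ S := by
  by_contra hwS
  have := hmax _ _ _ (h.cons hw.symm hwS)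
  rw [Set.ncard_insert_of_notMem hwS] at this
  omega

/-- If the ends of a longest path are adjacent, then the path covers the whole graph. -/
lemma HasPathOn.eq_univ_of_longest (hG : ∀ z, (G.induce {u | u ≠ z}).Connected)
    (h : G.HasPathOn x y S) (hxy : G.Adj x y)
    (hmax : ∀ x' y' S', G.HasPathOn x' y' S' → S'.ncard ≤ S.ncard) : S = Set.univ := by
  by_contra hne
  obtain ⟨w, hw⟩ := (Set.ne_univ_iff_exists_notMem S).1 hne
  obtain ⟨a, ha, b, rfl, T, hT, -, hTS, -⟩ := exists_hasPathOn_between (hG x) (X := S) (Y := {w})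
    h.right_mem hxy.ne' rfl (by rintro rfl; exact hw h.left_mem)
  obtain ⟨c, hc⟩ := h.exists_rotate hxy ha
  have := hmax _ _ _ (hT.symm.append hc (by grind))
  have hlt : S ⊂ T ∪ S :=
    ⟨Set.subset_union_right, fun hle ↦ hw (hle (.inl hT.right_mem))⟩
  exact absurd this (Set.ncard_lt_ncard hlt).not_ge

end Longest

namespace IsPathSeq

variable {v : ℕ → V} {m : ℕ}

lemma ncard_image (hv : G.IsPathSeq v m) {I : Finset ℕ} (hI : ∀ i ∈ I, i ≤ m) :
    (v '' I).ncard = I.card := by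
  have hinj : Set.InjOn v I := fun i hi j hj h ↦ hv.inj i (hI i hi) j (hI j hj) h
  rw [hinj.ncard_image, Set.ncard_coe_finset]

variable [Finite V] {d : ℕ}

lemma exists_isCycle_of_crossing (hG : ∀ z, (G.induce {u | u ≠ z}).Connected)
    (hv : G.IsPathSeq v m)
    (hmax : ∀ x' y' S', G.HasPathOn x' y' S' → S'.ncard ≤ (v '' Set.Iic m).ncard)
    (hd : 1 < d) (hcard : 2 * d ≤ Nat.card V) {D E : Finset ℕ}
    (hD : ∀ k, k ∈ D ↔ k ≤ m ∧ G.Adj (v 0) (v k)) (hE : ∀ k, k ∈ E ↔ k ≤ m ∧ G.Adj (v m) (v k))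
    (hDc : d ≤ D.card) (hEc : d ≤ E.card) {i j : ℕ} (hi : i ∈ E) (hj : j ∈ D) (hij : i < j) :
    ∃ (x : V) (c : G.Walk x x), c.IsCycle ∧ 2 * d ≤ c.length := by
  classical
  have hex : ∃ l, 0 < l ∧ ∃ i, i ∈ E ∧ i + l ∈ D :=
    ⟨j - i, by omega, i, hi, by rwa [show i + (j - i) = j by omega]⟩
  obtain ⟨i, j, hij, hi, hj, hmin⟩ : ∃ i j, i < j ∧ i ∈ E ∧ j ∈ D ∧
      ∀ i' ∈ E, ∀ j' ∈ D, i' < j' → j - i ≤ j' - i' := by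
    obtain ⟨hl, i, hi, hj⟩ := Nat.find_spec hex
    refine ⟨i, i + Nat.find hex, by omega, hi, hj, fun i' hi' j' hj' h ↦ ?_⟩
    have := Nat.find_min' hex (m := j' - i')
      ⟨by omega, i', hi', by rwa [show i' + (j' - i') = j' by omega]⟩
    omega
  clear hex
  have hi' := (hE i).1 hi
  have hj' := (hD j).1 hj
  set I : Finset ℕ := Finset.Icc 0 i ∪ Finset.Icc j m with hI
  have hIm : ∀ k ∈ I, k ≤ m := by simp [hI]; omega
  have hP : G.HasPathOn (v 0) (v j) (v '' I) := by
    rw [hI, Finset.coe_union, Finset.coe_Icc, Finset.coe_Icc, Set.image_union]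
    refine (hv.hasPathOn i.zero_le hi'.1).append_adj (hv.hasPathOn hj'.1 le_rfl).symm
      hi'.2.symm (hv.disjoint_image (by simp; omega) (by simp) ?_)
    rw [Set.disjoint_left]
    simp
    omega
  have hlen : 2 * d ≤ (v '' I).ncard := by
    by_cases hji : j = i + 1
    · have hIi : (I : Set ℕ) = Set.Iic m := by
        ext k
        simp [hI]
        omega
      rw [← hIi] at hmax
      rwa [hP.eq_univ_of_longest hG hj'.2 hmax, Set.ncard_univ]
    · rw [hv.ncard_image hIm]
      have hE' : ((E.erase i).image (· + 1)).card = E.card - 1 := by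
        rw [Finset.card_image_of_injective _ (add_left_injective 1), Finset.card_erase_of_mem hi]
      have hdisj : Disjoint D ((E.erase i).image (· + 1)) := by
        rw [Finset.disjoint_left]
        intro k hk hk'
        obtain ⟨l, hl, rfl⟩ := Finset.mem_image.1 hk'
        have := hmin l (Finset.mem_of_mem_erase hl) _ hk (by omega)
        omega
      have h0 : 0 ∉ D ∪ (E.erase i).image (· + 1) := by simp [hD]
      have hsub : insert 0 (D ∪ (E.erase i).image (· + 1)) ⊆ I := by
        intro k hk
        simp only [hI, Finset.mem_union, Finset.mem_Icc]
        rw [Finset.mem_insert, Finset.mem_union, Finset.mem_image] at hk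
        rcases hk with rfl | hk | ⟨l, hl, rfl⟩
        · omega
        · have := (hD k).1 hk
          have := hmin i hi k hk
          omega
        · obtain ⟨hli, hl⟩ := Finset.mem_erase.1 hl
          have h₁ := (hE l).1 hl
          have h₂ : l ≠ m := by rintro rfl; exact h₁.2.ne rfl
          have := hmin l hl j hj
          omega
      have := Finset.card_le_card hsub
      rw [Finset.card_insert_of_notMem h0, Finset.card_union_of_disjoint hdisj, hE'] at this
      omega
  obtain ⟨x, c, hc, hcl⟩ := hP.exists_isCycle hj'.2 (by omega)
  exact ⟨x, c, hc, hcl ▸ hlen⟩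

lemma exists_isCycle_of_not_crossing (hG : ∀ z, (G.induce {u | u ≠ z}).Connected)
    (hv : G.IsPathSeq v m) (hd : 1 < d) {D E : Finset ℕ}
    (hD : ∀ k, k ∈ D ↔ k ≤ m ∧ G.Adj (v 0) (v k)) (hE : ∀ k, k ∈ E ↔ k ≤ m ∧ G.Adj (v m) (v k))
    (hDc : d ≤ D.card) (hEc : d ≤ E.card) (hcross : ∀ i ∈ E, ∀ j ∈ D, j ≤ i) :
    ∃ (x : V) (c : G.Walk x x), c.IsCycle ∧ 2 * d ≤ c.length := by
  classical
  have hDn : D.Nonempty := Finset.card_pos.1 (by omega)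
  have hEn : E.Nonempty := Finset.card_pos.1 (by omega)
  obtain ⟨s, hs, hsmax⟩ := D.exists_max_image id hDn
  obtain ⟨t, ht, htmin⟩ := E.exists_min_image id hEn
  have hst := hcross t ht s hs
  have hs' := (hD s).1 hs
  have ht' := (hE t).1 ht
  have hs0 : s ≠ 0 := by rintro rfl; exact hs'.2.ne rfl
  have htm : t ≠ m := by rintro rfl; exact ht'.2.ne rfl
  have hA : ∀ k ≤ m, v k ∈ v '' Set.Icc 0 s → k ≤ s := fun k hk h ↦
    ((hv.mem_image_iff (by simp; omega) hk).1 h).2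
  obtain ⟨x, hx, y, hy, b, R₁, R₂, hxy, htb, hbm, h₁, h₂, hd₁₂, hA₁, hA₂, hq₁, hq₂⟩ :=
    exists_linkage hG (hv.shift s) (A := v '' Set.Icc 0 s) ⟨s, by simp, rfl⟩
      (fun i hi h ↦ by have := hA _ (by omega) h; omega) (a := v 0) ⟨0, by simp, rfl⟩
      (fun h ↦ by have := hv.inj _ (by omega) _ (by omega) h; omega) (t := t - s) (by omega)
  simp only [add_zero, show s + (t - s) = t by omega] at hxy h₁ h₂ hq₁ hq₂
  rw [Set.disjoint_left] at hd₁₂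
  have hne : x ≠ y := by
    rintro rfl
    exact hd₁₂ h₁.left_mem h₂.left_mem
  obtain ⟨S, hSA, hS, hSn⟩ := hv.exists_hasPathOn_neighbors' hs'.1 hs'.2 hx hy hne hxy
  obtain ⟨T, hTB, hT, hTn⟩ := hv.reverse.exists_hasPathOn_neighbors (a := m - (s + b))
    (s := m - t) (by omega) (by omega) (by simpa [show m - (m - t) = t by omega] using ht'.2)
  simp only [show m - (m - (s + b)) = s + b by omega, show m - (m - t) = t by omega,
    Nat.sub_zero] at hT hTn
  have hTB' : ∀ a ∈ T, ∃ k, t ≤ k ∧ k ≤ m ∧ v k = a := by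
    intro a ha
    obtain ⟨k, hk, rfl⟩ := hTB ha
    exact ⟨m - k, by have := hk.2; omega, by omega, rfl⟩
  have hTR₁ : ∀ a ∈ T, a ∈ R₁ → a = v t := by
    intro a ha ha'
    obtain ⟨k, hk, hkm, rfl⟩ := hTB' a ha
    have := hq₁ (k - s) (by omega) (by omega) (by rwa [show s + (k - s) = k by omega])
    congr 1
    omega
  have hTR₂ : ∀ a ∈ T, a ∈ R₂ → a = v (s + b) := by
    intro a ha ha'
    obtain ⟨k, hk, hkm, rfl⟩ := hTB' a ha
    have := hq₂ (k - s) (by omega) (by omega) (by rwa [show s + (k - s) = k by omega])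
    congr 1
    omega
  have hTS : ∀ a ∈ T, a ∈ S → a = v s := by
    intro a ha ha'
    obtain ⟨k, hk, hkm, rfl⟩ := hTB' a ha
    have := hA k hkm (hSA ha')
    congr 1
    omega
  have hpath : G.HasPathOn x y (R₁ ∪ T ∪ R₂) :=
    (h₁.append hT.symm fun a ha ↦ hTR₁ a ha.2 ha.1).append h₂.symm (by
      rintro a ⟨ha | ha, ha'⟩
      · exact (hd₁₂ ha ha').elim
      · exact hTR₂ a ha ha')
  set K := insert 0 D ∪ insert m E with hK
  have hKm : ∀ k ∈ K, k ≤ m := by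
    intro k
    simp [hK, hD, hE]
    omega
  have hKc : 2 * d + 1 ≤ K.card := by
    have hI : insert 0 D ∩ insert m E ⊆ {s} := by
      intro k hk
      rw [Finset.mem_inter, Finset.mem_insert, Finset.mem_insert] at hk
      have h₁ := hsmax k
      have h₂ := htmin k
      simp only [id] at h₁ h₂
      rw [Finset.mem_singleton]
      grind
    have h₀ : 0 ∉ D := by simp [hD]
    have h₀' : m ∉ E := by simp [hE]
    have := Finset.card_union_add_card_inter (insert 0 D) (insert m E)
    have := Finset.card_le_card hI
    rw [Finset.card_singleton] at this
    have := Finset.card_insert_of_notMem h₀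
    have := Finset.card_insert_of_notMem h₀'
    rw [hK]
    omega
  have hKU : v '' K ⊆ R₁ ∪ T ∪ R₂ ∪ S := by
    rintro _ ⟨k, hk, rfl⟩
    rw [hK, Finset.coe_union, Set.mem_union, Finset.mem_coe, Finset.mem_coe, Finset.mem_insert,
      Finset.mem_insert] at hk
    rcases hk with hk | hk
    · refine .inr (hSn k ?_ (hk.imp_right fun h ↦ ((hD k).1 h).2))
      rcases hk with rfl | hk
      exacts [s.zero_le, hsmax k hk]
    · have hkt : t ≤ k ∧ k ≤ m := by
        rcases hk with rfl | hk
        exacts [⟨ht'.1, le_rfl⟩, ⟨htmin k hk, ((hE k).1 hk).1⟩]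
      have := hTn (m - k) (by omega)
        (hk.imp (fun h ↦ by omega) fun h ↦ by
          rw [show m - (m - k) = k by omega]; exact ((hE k).1 h).2)
      rw [show m - (m - k) = k by omega] at this
      exact .inl (.inl (.inr this))
  have hlen := Set.ncard_le_ncard hKU
  rw [hv.ncard_image hKm] at hlen
  obtain ⟨u, c, hc, hcl⟩ := hpath.exists_isCycle_union hS hne (by
    rintro a ⟨(ha | ha) | ha, ha'⟩
    · exact .inl (hA₁ a ha (hSA ha'))
    · rw [hTS a ha ha']
      exact hxy
    · exact .inr (hA₂ a ha (hSA ha'))) (by omega)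
  exact ⟨u, c, hc, by omega⟩

end IsPathSeq

/-- Dirac: a 2-connected graph with minimum degree at least `d` on at least `2 * d` vertices
has a cycle of length at least `2 * d`. -/
theorem exists_isCycle_two_mul_le_length [Finite V]
    (hG : ∀ z, (G.induce {u | u ≠ z}).Connected) {d : ℕ} (hd : 1 < d)
    (hcard : 2 * d ≤ Nat.card V) (hdeg : ∀ v, d ≤ (G.neighborSet v).ncard) :
    ∃ (x : V) (c : G.Walk x x), c.IsCycle ∧ 2 * d ≤ c.length := by
  classical
  have : Nonempty V := (Nat.card_pos_iff.1 (by omega)).1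
  obtain ⟨x, y, S, hS, hmax⟩ := G.exists_longest_hasPathOn
  obtain ⟨v, m, hv, rfl, rfl, rfl⟩ := hS.exists_isPathSeq
  have key : ∀ a : V, (∀ w, G.Adj a w → w ∈ v '' Set.Iic m) →
      d ≤ ((Finset.range (m + 1)).filter fun k ↦ G.Adj a (v k)).card := by
    intro a ha
    rw [← hv.ncard_image (by simp; omega)]
    refine (hdeg a).trans (Set.ncard_le_ncard fun w hw ↦ ?_)
    obtain ⟨k, hk, rfl⟩ := ha w hw
    exact ⟨k, by simpa [Nat.lt_succ_iff] using ⟨hk, hw⟩, rfl⟩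
  have hDc := key (v 0) fun w hw ↦ hS.mem_of_adj_of_longest hmax hw
  have hEc := key (v m) fun w hw ↦ hS.symm.mem_of_adj_of_longest hmax hw
  set D := (Finset.range (m + 1)).filter fun k ↦ G.Adj (v 0) (v k) with hDdef
  set E := (Finset.range (m + 1)).filter fun k ↦ G.Adj (v m) (v k) with hEdef
  have hD : ∀ k, k ∈ D ↔ k ≤ m ∧ G.Adj (v 0) (v k) := by simp [hDdef]
  have hE : ∀ k, k ∈ E ↔ k ≤ m ∧ G.Adj (v m) (v k) := by simp [hEdef]
  by_cases hcross : ∀ i ∈ E, ∀ j ∈ D, j ≤ i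
  · exact hv.exists_isCycle_of_not_crossing hG hd hD hE hDc hEc hcross
  · push Not at hcross
    obtain ⟨i, hi, j, hj, hij⟩ := hcross
    exact hv.exists_isCycle_of_crossing hG hmax hd hcard hD hE hDc hEc hi hj hij

end SimpleGraph

/-- Dirac. Any 2-connected graph `G` on `n` vertices with minimum degree
`δ(G) = d`, where `1 < d ≤ n/2`, contains a cycle of length at least `2d`. -/
theorem statement17 {V : Type*} [Fintype V]
    (n : ℕ) (hn : Fintype.card V = n)
    (G : SimpleGraph V) (h2conn : TwoConnected G)
    (d : ℕ) (hd1 : 1 < d) (hd2 : 2 * d ≤ n)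
    (hmin : ∀ v : V, d ≤ (G.neighborSet v).ncard)
    (hmin' : ∃ v : V, (G.neighborSet v).ncard = d) :
    ∃ (x : V) (c : G.Walk x x), c.IsCycle ∧ 2 * d ≤ c.length := by
  exact SimpleGraph.exists_isCycle_two_mul_le_length h2conn.2 hd1
    (by rwa [Nat.card_eq_fintype_card, hn]) hmin
end
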